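/- arXiv:2103.05474 — 2 statements merged into one kernel-verified Lean document; each statement's English description precedes it below -/
import Mathlib

section
/- Let Z = {Z_k}_{k≥1} be a positive Harris recurrent Markov chain on Z = X × Y with stationary probability measure π and maximal irreducibility measure ψ. For fixed r > 1, define the overlapping r-block process Z^(r) = {Z^(r)_k}_{k≥1} by Z^(r)_k := Z_{k:k+r-1}, a Markov chain on Z^r. Then Z^(r) is a positive Harris chain whose maximal irreducibility measure is ψ_r, where ψ_r(A) := ∫_{A_(1)} P(Z_{2:r} ∈ A(z₁) | Z₁ = z₁) ψ(dz₁) for A in the product σ-field on Z^r, with A_(1) := {z₁ : z_{1:r} ∈ A} the first-coordinate projection of A and A(z₁) := {z_{2:r} : z_{1:r} ∈ A}. -/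
open MeasureTheory ProbabilityTheory ENNReal

namespace PMMPaper

/-! ### General Markov chain notions (general state space) -/

section Kernels

variable {S : Type*} [MeasurableSpace S]

open Classical in
/-- `kpow κ k` is the `k`-step transition kernel of a Markov chain with one-step kernel `κ`. -/
noncomputable def kpow (κ : Kernel S S) : ℕ → Kernel S S
  | 0 => Kernel.id
  | n + 1 => kpow κ n ∘ₖ κ

/-- `φ` is an irreducibility measure for the chain with kernel `κ`:
`φ(A) > 0` implies that from every point `z` some `k`-step transition reaches `A`
with positive probability. -/
def IsIrreducibilityMeasure (κ : Kernel S S) (φ : Measure S) : Prop :=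
  ∀ A : Set S, MeasurableSet A → 0 < φ A → ∀ z : S, ∃ k : ℕ, 1 ≤ k ∧ 0 < kpow κ k z A

/-- `ψ` is a maximal irreducibility measure: a σ-finite irreducibility measure dominating
every other σ-finite irreducibility measure. -/
def IsMaxIrreducibilityMeasure (κ : Kernel S S) (ψ : Measure S) : Prop :=
  SigmaFinite ψ ∧ IsIrreducibilityMeasure κ ψ ∧
    ∀ φ : Measure S, SigmaFinite φ → IsIrreducibilityMeasure κ φ → φ ≪ ψ

/-- `Pz` is the family of laws (on the path space `ℕ → S`) of the Markov chain with
transition kernel `κ` started at the point `z`:  `Pz z` is a probability measure under which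
the coordinate process starts at `z` and is Markov with kernel `κ`. -/
def IsMarkovFamily (κ : Kernel S S) (Pz : S → Measure (ℕ → S)) : Prop :=
  (∀ z : S, IsProbabilityMeasure (Pz z)) ∧
  (∀ z : S, Pz z {ω | ω 0 = z} = 1) ∧
  ∀ (z : S) (n : ℕ) (g : S → ℝ≥0∞), Measurable g → ∀ C : Set (ℕ → S),
    MeasurableSet[⨆ i ∈ Set.Iic n, MeasurableSpace.comap (fun ω : ℕ → S => ω i) inferInstance] C →
    ∫⁻ ω in C, g (ω (n + 1)) ∂(Pz z) = ∫⁻ ω in C, ∫⁻ z', g z' ∂(κ (ω n)) ∂(Pz z)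

/-- Harris recurrence property (relative to the measure `ψ`): every set charged by `ψ` is
visited infinitely often, almost surely, from every starting point. -/
def HarrisProp (κ : Kernel S S) (Pz : S → Measure (ℕ → S)) (ψ : Measure S) : Prop :=
  ∀ A : Set S, MeasurableSet A → 0 < ψ A → ∀ z : S,
    Pz z {ω | ∀ N : ℕ, ∃ k : ℕ, N ≤ k ∧ ω k ∈ A} = 1

/-- `π` is an invariant measure for the kernel `κ`. -/
def IsInvariantMeasure (κ : Kernel S S) (π : Measure S) : Prop :=
  π.bind (fun z => κ z) = π

/-- The chain is positive: its transition kernel admits an invariant probability measure. -/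
def IsPositive (κ : Kernel S S) : Prop :=
  ∃ π : Measure S, IsProbabilityMeasure π ∧ IsInvariantMeasure κ π

/-- The process `Z` on `(Ω, P)` is a homogeneous Markov chain with transition kernel `κ`. -/
def IsMarkovChain {Ω : Type*} [MeasurableSpace Ω] (P : Measure Ω) (Z : ℕ → Ω → S)
    (κ : Kernel S S) : Prop :=
  (∀ k : ℕ, Measurable (Z k)) ∧
  ∀ (n : ℕ) (g : S → ℝ≥0∞), Measurable g → ∀ C : Set Ω,
    MeasurableSet[⨆ i ∈ Set.Iic n, MeasurableSpace.comap (Z i) inferInstance] C →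
    ∫⁻ ω in C, g (Z (n + 1) ω) ∂P = ∫⁻ ω in C, ∫⁻ z', g z' ∂(κ (Z n ω)) ∂P

/-- The process `Z : ℤ → Ω → S` on `(Ω, P)` is a (two-sided) homogeneous Markov chain
with transition kernel `κ`. -/
def IsMarkovChainZ {Ω : Type*} [MeasurableSpace Ω] (P : Measure Ω) (Z : ℤ → Ω → S)
    (κ : Kernel S S) : Prop :=
  (∀ k : ℤ, Measurable (Z k)) ∧
  ∀ (n : ℤ) (g : S → ℝ≥0∞), Measurable g → ∀ C : Set Ω,
    MeasurableSet[⨆ i ∈ Set.Iic n, MeasurableSpace.comap (Z i) inferInstance] C →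
    ∫⁻ ω in C, g (Z (n + 1) ω) ∂P = ∫⁻ ω in C, ∫⁻ z', g z' ∂(κ (Z n ω)) ∂P

/-- The reversed-time process of the two-sided chain `Z` is a Markov chain with kernel `κ'`. -/
def IsRevMarkovChainZ {Ω : Type*} [MeasurableSpace Ω] (P : Measure Ω) (Z : ℤ → Ω → S)
    (κ' : Kernel S S) : Prop :=
  ∀ (n : ℤ) (g : S → ℝ≥0∞), Measurable g → ∀ C : Set Ω,
    MeasurableSet[⨆ i ∈ Set.Ici n, MeasurableSpace.comap (Z i) inferInstance] C →
    ∫⁻ ω in C, g (Z (n - 1) ω) ∂P = ∫⁻ ω in C, ∫⁻ z', g z' ∂(κ' (Z n ω)) ∂P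

/-- The two-sided process `Z` is stationary: all finite-dimensional distributions are
invariant under time shifts. -/
def IsStationaryZ {Ω : Type*} [MeasurableSpace Ω] (P : Measure Ω) (Z : ℤ → Ω → S) : Prop :=
  ∀ (k : ℤ) (n : ℕ),
    P.map (fun ω => fun i : Fin n => Z (k + (i : ℕ)) ω) =
      P.map (fun ω => fun i : Fin n => Z ((i : ℕ) : ℤ) ω)

/-- First-coordinate projection `A_(1)` of a set of finite strings. -/
def proj1 {α : Type*} {R : ℕ} (A : Set (Fin (R + 1) → α)) : Set α :=
  (fun x => x 0) '' A

/-- The section `A(a) = {x_{2:r} : (a, x_{2:r}) ∈ A}`. -/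
def secSet {α : Type*} {R : ℕ} (A : Set (Fin (R + 1) → α)) (a : α) : Set (Fin R → α) :=
  {xr | Fin.cons a xr ∈ A}

end Kernels

/-! ### Pairwise Markov models -/

variable {𝓧 : Type*} [MeasurableSpace 𝓧] {𝓨 : Type*} [Fintype 𝓨] [DecidableEq 𝓨]
  [MeasurableSpace 𝓨] [MeasurableSingletonClass 𝓨] [Nonempty 𝓨]
  {Ω : Type*} [MeasurableSpace Ω]

/-- `Z` is a pairwise Markov model on `(Ω, P)`: a homogeneous Markov chain on `𝓧 × 𝓨`
whose transition kernel `κ` has density `q(z'|z)` with respect to `μ × count`, and whose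
initial distribution has density `p0` with respect to `μ × count`. -/
def IsPMM (P : Measure Ω) (Z : ℕ → Ω → 𝓧 × 𝓨) (κ : Kernel (𝓧 × 𝓨) (𝓧 × 𝓨))
    (μ : Measure 𝓧) (q : 𝓧 × 𝓨 → 𝓧 × 𝓨 → ℝ≥0∞) (p0 : 𝓧 × 𝓨 → ℝ≥0∞) : Prop :=
  IsProbabilityMeasure P ∧ IsMarkovChain P Z κ ∧ SigmaFinite μ ∧
  Measurable (Function.uncurry q) ∧ Measurable p0 ∧
  (∀ z : 𝓧 × 𝓨, (κ z : Measure (𝓧 × 𝓨)) =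
      (μ.prod Measure.count).withDensity (fun z' => q z' z)) ∧
  P.map (Z 0) = (μ.prod Measure.count).withDensity p0

/-- Two-sided version of `IsPMM`. -/
def IsPMMZ (P : Measure Ω) (Z : ℤ → Ω → 𝓧 × 𝓨) (κ : Kernel (𝓧 × 𝓨) (𝓧 × 𝓨))
    (μ : Measure 𝓧) (q : 𝓧 × 𝓨 → 𝓧 × 𝓨 → ℝ≥0∞) (p0 : 𝓧 × 𝓨 → ℝ≥0∞) : Prop :=
  IsProbabilityMeasure P ∧ IsMarkovChainZ P Z κ ∧ SigmaFinite μ ∧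
  Measurable (Function.uncurry q) ∧ Measurable p0 ∧
  (∀ z : 𝓧 × 𝓨, (κ z : Measure (𝓧 × 𝓨)) =
      (μ.prod Measure.count).withDensity (fun z' => q z' z)) ∧
  P.map (Z 0) = (μ.prod Measure.count).withDensity p0

/-- `pijD q x i j` is the conditional density
`p_{ij}(x_{1:r}) = p(x_{2:r}, y_r = j | x_1, y_1 = i)` (a string `x` of length `R+1`). -/
noncomputable def pijD (q : 𝓧 × 𝓨 → 𝓧 × 𝓨 → ℝ≥0∞) {R : ℕ} (x : Fin (R + 1) → 𝓧)
    (i j : 𝓨) : ℝ≥0∞ :=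
  ∑ y : Fin (R + 1) → 𝓨,
    (if y 0 = i ∧ y (Fin.last R) = j then
      ∏ k : Fin R, q (x k.succ, y k.succ) (x k.castSucc, y k.castSucc) else 0)

/-- `pmidD q x i t j` is the density `p(y_{t+1} = j, x_{2:r} | x_1, y_1 = i)`. -/
noncomputable def pmidD (q : 𝓧 × 𝓨 → 𝓧 × 𝓨 → ℝ≥0∞) {R : ℕ} (x : Fin (R + 1) → 𝓧)
    (i : 𝓨) (t : Fin (R + 1)) (j : 𝓨) : ℝ≥0∞ :=
  ∑ y : Fin (R + 1) → 𝓨,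
    (if y 0 = i ∧ y t = j then
      ∏ k : Fin R, q (x k.succ, y k.succ) (x k.castSucc, y k.castSucc) else 0)

/-- `pxD q x i = p(x_{2:r} | x_1, y_1 = i)`. -/
noncomputable def pxD (q : 𝓧 × 𝓨 → 𝓧 × 𝓨 → ℝ≥0∞) {R : ℕ} (x : Fin (R + 1) → 𝓧)
    (i : 𝓨) : ℝ≥0∞ :=
  ∑ j : 𝓨, pijD q x i j

/-- The set `Y⁺(x_{1:r}) = {(i,j) : p_{ij}(x_{1:r}) > 0}`. -/
def Yplus (q : 𝓧 × 𝓨 → 𝓧 × 𝓨 → ℝ≥0∞) {R : ℕ} (x : Fin (R + 1) → 𝓧) : Set (𝓨 × 𝓨) :=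
  {p : 𝓨 × 𝓨 | 0 < pijD q x p.1 p.2}

/-- Joint density `p(x_{1:r}, y_{1:r})` of `Z_{1:r}`, built from the initial density `p0`
and the transition density `q`. -/
noncomputable def jointD (p0 : 𝓧 × 𝓨 → ℝ≥0∞) (q : 𝓧 × 𝓨 → 𝓧 × 𝓨 → ℝ≥0∞) {R : ℕ}
    (x : Fin (R + 1) → 𝓧) (y : Fin (R + 1) → 𝓨) : ℝ≥0∞ :=
  p0 (x 0, y 0) * ∏ k : Fin R, q (x k.succ, y k.succ) (x k.castSucc, y k.castSucc)

/-- Density `p(x_{1:r})` of the observations `X_{1:r}`. -/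
noncomputable def pXD (p0 : 𝓧 × 𝓨 → ℝ≥0∞) (q : 𝓧 × 𝓨 → 𝓧 × 𝓨 → ℝ≥0∞) {R : ℕ}
    (x : Fin (R + 1) → 𝓧) : ℝ≥0∞ :=
  ∑ y : Fin (R + 1) → 𝓨, jointD p0 q x y

/-- The set `Y*(x_{1:r}) = {(y_1, y_r) : ∃ y_{2:r-1}, p(x_{1:r}, y_{1:r}) > 0}`. -/
def Ystar (p0 : 𝓧 × 𝓨 → ℝ≥0∞) (q : 𝓧 × 𝓨 → 𝓧 × 𝓨 → ℝ≥0∞) {R : ℕ}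
    (x : Fin (R + 1) → 𝓧) : Set (𝓨 × 𝓨) :=
  {p : 𝓨 × 𝓨 | ∃ y : Fin (R + 1) → 𝓨,
    y 0 = p.1 ∧ y (Fin.last R) = p.2 ∧ 0 < jointD p0 q x y}

/-- Assumption **A1**: there is `r = R + 1 > 1` and a set `E ⊆ 𝓧^r` on which
`Y⁺(x_{1:r}) = Y⁺` is constant, nonempty, and a product set. -/
def Assumption1 (q : 𝓧 × 𝓨 → 𝓧 × 𝓨 → ℝ≥0∞) {R : ℕ} (E : Set (Fin (R + 1) → 𝓧))
    (Yp : Set (𝓨 × 𝓨)) : Prop :=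
  1 ≤ R ∧ Yp.Nonempty ∧ (∀ x ∈ E, Yplus q x = Yp) ∧
    Yp = (Prod.fst '' Yp) ×ˢ (Prod.snd '' Yp)

/-- Assumption **A2**: `ψ` is a maximal irreducibility measure for the chain,
`ψ(E_(1) × Y⁺_(1)) > 0` and `μ^{r-1}(E(x₁)) > 0` for all `x₁ ∈ E_(1)`. -/
def Assumption2 (κ : Kernel (𝓧 × 𝓨) (𝓧 × 𝓨)) (ψ : Measure (𝓧 × 𝓨)) (μ : Measure 𝓧)
    {R : ℕ} (E : Set (Fin (R + 1) → 𝓧)) (Yp : Set (𝓨 × 𝓨)) : Prop :=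
  IsMaxIrreducibilityMeasure κ ψ ∧
  0 < ψ (proj1 E ×ˢ (Prod.fst '' Yp)) ∧
  ∀ x₁ ∈ proj1 E, 0 < (Measure.pi fun _ : Fin R => μ) (secSet E x₁)

/-- Assumption **A1'** (stationary case): `Y*(x_{1:r}) = Y*` is constant on `E`,
nonempty and a product set. -/
def Assumption1' (p0 : 𝓧 × 𝓨 → ℝ≥0∞) (q : 𝓧 × 𝓨 → 𝓧 × 𝓨 → ℝ≥0∞) {R : ℕ}
    (E : Set (Fin (R + 1) → 𝓧)) (Ys : Set (𝓨 × 𝓨)) : Prop :=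
  1 ≤ R ∧ Ys.Nonempty ∧ (∀ x ∈ E, Ystar p0 q x = Ys) ∧
    Ys = (Prod.fst '' Ys) ×ˢ (Prod.snd '' Ys)

/-- Assumption **A2'**: `μ^r(E) > 0`. -/
def Assumption2' (μ : Measure 𝓧) {R : ℕ} (E : Set (Fin (R + 1) → 𝓧)) : Prop :=
  0 < (Measure.pi fun _ : Fin (R + 1) => μ) E

/-! ### Smoothing distributions -/

/-- The σ-algebra `σ(X_{l:n})` generated by the observations with indices in `[l, n]`. -/
noncomputable def obsSigma (Z : ℕ → Ω → 𝓧 × 𝓨) (l n : ℕ) : MeasurableSpace Ω :=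
  ⨆ i ∈ Set.Icc l n, MeasurableSpace.comap (fun ω => (Z i ω).1) inferInstance

/-- The σ-algebra `σ(X_{s:∞})` generated by the observations with indices `≥ s`. -/
noncomputable def obsSigmaFrom (Z : ℕ → Ω → 𝓧 × 𝓨) (s : ℕ) : MeasurableSpace Ω :=
  ⨆ i ∈ Set.Ici s, MeasurableSpace.comap (fun ω => (Z i ω).1) inferInstance

/-- The smoothing probability `ν^t_{l:n;m}(v) = P(Y_{t:t+m-1} = v | X_{l:n})`,
realized as a conditional expectation of an indicator. -/
noncomputable def smooth (P : Measure Ω) (Z : ℕ → Ω → 𝓧 × 𝓨) (t l n : ℕ) {m : ℕ}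
    (v : Fin m → 𝓨) : Ω → ℝ :=
  P[Set.indicator {ω | ∀ i : Fin m, (Z (t + (i : ℕ)) ω).2 = v i} (fun _ => (1 : ℝ)) |
    obsSigma Z l n]

/-- Total variation distance `‖ν^t_{l:n;m} − ν^t_{s:n;m}‖_TV`. -/
noncomputable def tvBlock (P : Measure Ω) (Z : ℕ → Ω → 𝓧 × 𝓨) (t l s n m : ℕ) (ω : Ω) : ℝ :=
  ∑ v : Fin m → 𝓨, |smooth P Z t l n v ω - smooth P Z t s n v ω|

/-- Two-sided version: the σ-algebra `σ(X_i ; i ∈ I)` for `I ⊆ ℤ`. -/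
noncomputable def obsSigmaZ (Z : ℤ → Ω → 𝓧 × 𝓨) (I : Set ℤ) : MeasurableSpace Ω :=
  ⨆ i ∈ I, MeasurableSpace.comap (fun ω => (Z i ω).1) inferInstance

/-- Two-sided smoothing probability `P(Y_{t:t+m-1} = v | X_i ; i ∈ I)`. -/
noncomputable def smoothZ (P : Measure Ω) (Z : ℤ → Ω → 𝓧 × 𝓨) (t : ℤ) (I : Set ℤ) {m : ℕ}
    (v : Fin m → 𝓨) : Ω → ℝ :=
  P[Set.indicator {ω | ∀ i : Fin m, (Z (t + (i : ℕ)) ω).2 = v i} (fun _ => (1 : ℝ)) |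
    obsSigmaZ Z I]

/-- Two-sided total variation distance between smoothing distributions with observation
index sets `I` and `J`. -/
noncomputable def tvBlockZ (P : Measure Ω) (Z : ℤ → Ω → 𝓧 × 𝓨) (t : ℤ) (I J : Set ℤ)
    (m : ℕ) (ω : Ω) : ℝ :=
  ∑ v : Fin m → 𝓨, |smoothZ P Z t I v ω - smoothZ P Z t J v ω|

/-! ### Counters, Doeblin matrices -/

/-- `κ_k(X_{s:t})`: the number of (almost non-overlapping) `E`-blocks of length `R+1`
in the observed string, counting from position `s + k` (paper's `κ_k`, `r' = R`). -/
noncomputable def kapCount (Z : ℕ → Ω → 𝓧 × 𝓨) {R : ℕ} (E : Set (Fin (R + 1) → 𝓧))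
    (s t kk : ℕ) (ω : Ω) : ℕ :=
  ∑ u ∈ Finset.range ((t - kk - s) / R),
    Set.indicator E (fun _ => 1) (fun i : Fin (R + 1) => (Z (u * R + s + kk + (i : ℕ)) ω).1)

/-- `κ̄(X_{s:t})`: the backward counter, counting `E`-blocks from position `t` backwards. -/
noncomputable def kapBar (Z : ℕ → Ω → 𝓧 × 𝓨) {R : ℕ} (E : Set (Fin (R + 1) → 𝓧))
    (s t : ℕ) (ω : Ω) : ℕ :=
  ∑ u ∈ Finset.range ((t - s) / R),
    Set.indicator E (fun _ => 1) (fun i : Fin (R + 1) => (Z (t - (u + 1) * R + (i : ℕ)) ω).1)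

open Classical in
/-- The segment `x_{a+1:b+1}` (0-based indices `a..b`) of a string of length `L+1`. -/
def segv {L : ℕ} (x : Fin (L + 1) → 𝓧) (a b : ℕ) (hab : a ≤ b) (hb : b ≤ L) :
    Fin (b - a + 1) → 𝓧 :=
  fun i => x ⟨a + (i : ℕ), by omega⟩

/-- Normalizing constant `c(x_{r:n}) = ∑_{j ∈ Y₂} p(x_{r+1:n} | x_r, y_r = j)`. -/
noncomputable def normC (q : 𝓧 × 𝓨 → 𝓧 × 𝓨 → ℝ≥0∞) (Y2 : Set 𝓨) {M : ℕ}
    (w : Fin (M + 1) → 𝓧) : ℝ≥0∞ :=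
  ∑ j : 𝓨, Set.indicator Y2 (fun j' => pxD q w j') j

/-- The probability vector `λ[x_{r:n}](j)`. -/
noncomputable def lamD (q : 𝓧 × 𝓨 → 𝓧 × 𝓨 → ℝ≥0∞) (Y2 : Set 𝓨) {M : ℕ}
    (w : Fin (M + 1) → 𝓧) (j : 𝓨) : ℝ≥0∞ :=
  Set.indicator Y2 (fun j' => pxD q w j') j / normC q Y2 w

/-- The matrix `U[x_{1:n}](i,j)`; a version of `P(Y_r = j | X_{1:n} = x_{1:n}, Y_1 = i)`. -/
noncomputable def UMat (q : 𝓧 × 𝓨 → 𝓧 × 𝓨 → ℝ≥0∞) (Y2 : Set 𝓨) {L R : ℕ} (hR : R ≤ L)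
    (x : Fin (L + 1) → 𝓧) (i j : 𝓨) : ℝ≥0∞ :=
  if 0 < pxD q x i then pmidD q x i ⟨R, by omega⟩ j / pxD q x i
  else lamD q Y2 (segv x R L hR (le_refl L)) j

/-! ### Total variation of measures, conditional laws of `Y_{t:∞}` -/

open Classical in
/-- Total variation distance between two measures (normalized as in the paper:
`‖P − Q‖_TV = 2 sup_A |P(A) − Q(A)|`). -/
noncomputable def tvDistM {W : Type*} [MeasurableSpace W] (ρ₁ ρ₂ : Measure W) : ℝ≥0∞ :=
  2 * ⨆ (A : Set W) (_ : MeasurableSet A), ((ρ₁ A - ρ₂ A) ⊔ (ρ₂ A - ρ₁ A))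

/-- The observation vector `X_{l:n}`. -/
def obsVec (Z : ℕ → Ω → 𝓧 × 𝓨) (l n : ℕ) (ω : Ω) : Fin (n + 1 - l) → 𝓧 :=
  fun i => (Z (l + (i : ℕ)) ω).1

/-- The tail signal process `Y_{t:∞}`. -/
def tailY (Z : ℕ → Ω → 𝓧 × 𝓨) (t : ℕ) (ω : Ω) : ℕ → 𝓨 :=
  fun k => (Z (t + k) ω).2

/-- The observation tail `X_{l:∞}`. -/
def obsTail (Z : ℕ → Ω → 𝓧 × 𝓨) (l : ℕ) (ω : Ω) : ℕ → 𝓧 :=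
  fun k => (Z (l + k) ω).1

/-- A regular version of the conditional distribution `P(Y_{t:∞} ∈ · | X_{l:n})`,
evaluated at `ω`. -/
noncomputable def condLawTail (P : Measure Ω) [IsFiniteMeasure P] (Z : ℕ → Ω → 𝓧 × 𝓨)
    (t l n : ℕ) (ω : Ω) : Measure (ℕ → 𝓨) :=
  condDistrib (tailY Z t) (obsVec Z l n) P (obsVec Z l n ω)

/-- A regular version of the conditional distribution `P(Y_{t:∞} ∈ · | X_{l:∞})`,
evaluated at `ω`. -/
noncomputable def condLawTailInf (P : Measure Ω) [IsFiniteMeasure P] (Z : ℕ → Ω → 𝓧 × 𝓨)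
    (t l : ℕ) (ω : Ω) : Measure (ℕ → 𝓨) :=
  condDistrib (tailY Z t) (obsTail Z l) P (obsTail Z l ω)

/-! ### Hidden Markov models and matrices -/

/-- Powers of a nonnegative matrix on `𝓨`. -/
noncomputable def matpow (p : 𝓨 → 𝓨 → ℝ≥0∞) : ℕ → 𝓨 → 𝓨 → ℝ≥0∞
  | 0 => fun i j => if i = j then 1 else 0
  | n + 1 => fun i j => ∑ k : 𝓨, matpow p n i k * p k j

/-- The sub-matrix `ℙ_C` of `p` with rows and columns restricted to `C` (and `0` outside). -/
noncomputable def subMat (p : 𝓨 → 𝓨 → ℝ≥0∞) (C : Set 𝓨) : 𝓨 → 𝓨 → ℝ≥0∞ :=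
  fun i j => Set.indicator (C ×ˢ C) (fun ij : 𝓨 × 𝓨 => p ij.1 ij.2) (i, j)

/-- Support `G_i = {x : f_i(x) > 0}` of the emission density `f_i`. -/
def emisSupp (f : 𝓨 → 𝓧 → ℝ≥0∞) (i : 𝓨) : Set 𝓧 :=
  {x | 0 < f i x}

/-- `C` is a cluster: `μ[(∩_{i∈C} G_i) \ (∪_{i∉C} G_i)] > 0`. -/
def IsCluster (μ : Measure 𝓧) (f : 𝓨 → 𝓧 → ℝ≥0∞) (C : Set 𝓨) : Prop :=
  0 < μ ((⋂ i ∈ C, emisSupp f i) \ (⋃ i ∈ Cᶜ, emisSupp f i))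

/-! ### Auxiliary material for the proof -/

section Aux

variable {S : Type*} [MeasurableSpace S]

theorem kpow_zero (κ : Kernel S S) : kpow κ 0 = Kernel.id := rfl

theorem kpow_succ (κ : Kernel S S) (n : ℕ) : kpow κ (n + 1) = kpow κ n ∘ₖ κ := rfl

theorem kpow_succ' (κ : Kernel S S) (n : ℕ) : kpow κ (n + 1) = κ ∘ₖ kpow κ n := by
  induction n with
  | zero => rw [kpow_succ, kpow_zero, Kernel.id_comp, Kernel.comp_id]
  | succ n ih => rw [kpow_succ, ih, Kernel.comp_assoc, ← kpow_succ, ← ih]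

theorem kpow_add (κ : Kernel S S) (m n : ℕ) : kpow κ (m + n) = kpow κ m ∘ₖ kpow κ n := by
  induction n with
  | zero => rw [kpow_zero, Kernel.comp_id, Nat.add_zero]
  | succ n ih => rw [← Nat.add_assoc, kpow_succ, ih, Kernel.comp_assoc, ← kpow_succ]

theorem kpow_markov (κ : Kernel S S) [IsMarkovKernel κ] (n : ℕ) : IsMarkovKernel (kpow κ n) := by
  induction n with
  | zero => rw [kpow_zero]; infer_instance
  | succ n ih => rw [kpow_succ]; infer_instance

/-- The σ-algebra of the past up to time `n` on the path space. -/
def past (S : Type*) [MeasurableSpace S] (n : ℕ) : MeasurableSpace (ℕ → S) :=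
  ⨆ i ∈ Set.Iic n, MeasurableSpace.comap (fun ω : ℕ → S => ω i) inferInstance

theorem past_le (n : ℕ) : past S n ≤ (inferInstance : MeasurableSpace (ℕ → S)) := by
  refine iSup₂_le fun i _ => ?_
  exact (measurable_pi_apply i).comap_le

theorem past_mono {m n : ℕ} (h : m ≤ n) : past S m ≤ past S n :=
  biSup_mono fun _ hi => le_trans hi h

theorem past_eval {i n : ℕ} (h : i ≤ n) : Measurable[past S n] (fun ω : ℕ → S => ω i) := by
  rw [measurable_iff_comap_le]
  exact le_iSup₂_of_le (f := fun i (_ : i ∈ Set.Iic n) =>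
    MeasurableSpace.comap (fun ω : ℕ → S => ω i) inferInstance) i h le_rfl

/-- `P` is Markov with kernel `κ`. -/
def IsMk (κ : Kernel S S) (P : Measure (ℕ → S)) : Prop :=
  ∀ (n : ℕ) (g : S → ℝ≥0∞), Measurable g → ∀ C : Set (ℕ → S), MeasurableSet[past S n] C →
    ∫⁻ ω in C, g (ω (n + 1)) ∂P = ∫⁻ ω in C, ∫⁻ z', g z' ∂(κ (ω n)) ∂P

theorem IsMarkovFamily.isMk {κ : Kernel S S} {Pz : S → Measure (ℕ → S)}
    (h : IsMarkovFamily κ Pz) (z : S) : IsMk κ (Pz z) := h.2.2 z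

theorem IsMk.joint {κ : Kernel S S} [IsMarkovKernel κ] {P : Measure (ℕ → S)}
    [IsProbabilityMeasure P] (h : IsMk κ P) {T : Type*} [MeasurableSpace T] (n : ℕ)
    (V : (ℕ → S) → T) (hV : Measurable[past S n] V) (g : T → S → ℝ≥0∞)
    (hg : Measurable (Function.uncurry g)) :
    ∫⁻ ω, g (V ω) (ω (n + 1)) ∂P = ∫⁻ ω, ∫⁻ z', g (V ω) z' ∂(κ (ω n)) ∂P := by
  have hV' : Measurable V := hV.mono (past_le n) le_rfl
  let η : Kernel (ℕ → S) S := κ.comap (fun ω => ω n) (measurable_pi_apply n)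
  have key : P.map (fun ω => (V ω, ω (n + 1))) = (P ⊗ₘ η).map (Prod.map V id) := by
    have : IsFiniteMeasure (P.map (fun ω => (V ω, ω (n + 1)))) := inferInstance
    apply Measure.ext_prod
    intro s t hs ht
    have h1 := h n (t.indicator 1) (measurable_one.indicator ht) (V ⁻¹' s) (hV hs)
    rw [Measure.map_apply (by fun_prop) (hs.prod ht),
      Measure.map_apply (by fun_prop) (hs.prod ht)]
    have e2 : (Prod.map V id : _ × S → _) ⁻¹' s ×ˢ t = (V ⁻¹' s) ×ˢ t := by ext; simp
    rw [e2, Measure.compProd_apply_prod (hV' hs) ht]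
    simp only [lintegral_indicator_one ht] at h1
    have e3 : ∫⁻ ω in V ⁻¹' s, η ω t ∂P = ∫⁻ ω in V ⁻¹' s, κ (ω n) t ∂P := rfl
    rw [e3, ← h1]
    have e4 : (fun ω : ℕ → S => t.indicator (1 : S → ℝ≥0∞) (ω (n + 1)))
      = ((fun ω : ℕ → S => ω (n + 1)) ⁻¹' t).indicator 1 := rfl
    rw [e4, lintegral_indicator_one (measurable_pi_apply _ ht),
      Measure.restrict_apply (measurable_pi_apply _ ht)]
    congr 1
    ext; simp [and_comm]
  have := congrArg (fun m => ∫⁻ x, Function.uncurry g x ∂m) key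
  rw [lintegral_map hg (by fun_prop), lintegral_map hg (by fun_prop),
    Measure.lintegral_compProd (by fun_prop)] at this
  exact this

theorem IsMk.steps {κ : Kernel S S} {P : Measure (ℕ → S)} (h : IsMk κ P) (n m : ℕ)
    (g : S → ℝ≥0∞) (hg : Measurable g) (C : Set (ℕ → S)) (hC : MeasurableSet[past S n] C) :
    ∫⁻ ω in C, g (ω (n + m)) ∂P = ∫⁻ ω in C, ∫⁻ z', g z' ∂(kpow κ m (ω n)) ∂P := by
  induction m generalizing g with
  | zero => simp [kpow_zero, Kernel.id_apply, lintegral_dirac' _ hg]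
  | succ m ih =>
    rw [← Nat.add_assoc, h (n + m) g hg C (past_mono (Nat.le_add_right _ _) C hC),
      ih _ hg.lintegral_kernel]
    simp_rw [kpow_succ', Kernel.lintegral_comp _ _ _ hg]

/-- Two Markov laws with the same kernel and the same starting point agree. -/
theorem IsMk.unique [MeasurableSingletonClass S] {κ : Kernel S S} [IsMarkovKernel κ]
    {P Q : Measure (ℕ → S)}
    [IsProbabilityMeasure P] [IsProbabilityMeasure Q] (hP : IsMk κ P) (hQ : IsMk κ Q) (z : S)
    (hP0 : ∀ᵐ ω ∂P, ω 0 = z) (hQ0 : ∀ᵐ ω ∂Q, ω 0 = z) : P = Q := by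
  let V : ℕ → (ℕ → S) → (ℕ → S) := fun n ω k => ω (min k n)
  have hVm : ∀ n, Measurable[past S n] (V n) := fun n =>
    @measurable_pi_lambda _ _ _ (past S n) _ _ fun k => past_eval (min_le_right k n)
  have key : ∀ n (g : (ℕ → S) → ℝ≥0∞), Measurable g →
      ∫⁻ ω, g (V n ω) ∂P = ∫⁻ ω, g (V n ω) ∂Q := by
    intro n
    induction n with
    | zero =>
      intro g hg
      have e1 : ∫⁻ ω, g (V 0 ω) ∂P = ∫⁻ _, g (fun _ => z) ∂P := by
        apply lintegral_congr_ae
        filter_upwards [hP0] with ω hω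
        simp [V, hω]
      have e2 : ∫⁻ ω, g (V 0 ω) ∂Q = ∫⁻ _, g (fun _ => z) ∂Q := by
        apply lintegral_congr_ae
        filter_upwards [hQ0] with ω hω
        simp [V, hω]
      rw [e1, e2]; simp
    | succ n ih =>
      intro g hg
      let G : (ℕ → S) → S → ℝ≥0∞ := fun v s => g (fun k => if k ≤ n then v k else s)
      have hG : Measurable (Function.uncurry G) := by
        refine hg.comp (measurable_pi_lambda _ fun k => ?_)
        by_cases hk : k ≤ n
        · simp only [hk, if_true]; fun_prop
        · simp only [hk, if_false]; fun_prop
      have e : ∀ ω, g (V (n + 1) ω) = G (V n ω) (ω (n + 1)) := by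
        intro ω
        simp only [G, V]
        congr 1
        ext k
        split_ifs with hk
        · rw [min_eq_left hk, min_eq_left (by omega)]
        · rw [min_eq_right (by omega)]
      simp_rw [e]
      rw [hP.joint n (V n) (hVm n) G hG, hQ.joint n (V n) (hVm n) G hG]
      have e' : ∀ ω, ∫⁻ z', G (V n ω) z' ∂(κ (ω n))
          = (fun v : ℕ → S => ∫⁻ z', G v z' ∂(κ (v n))) (V n ω) := by
        intro ω; simp [V]
      simp_rw [e']
      refine ih (fun v : ℕ → S => ∫⁻ z', G v z' ∂(κ (v n))) ?_
      exact Measurable.lintegral_kernel_prod_right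
        (κ := κ.comap (fun v : ℕ → S => v n) (measurable_pi_apply n)) hG
  refine ext_of_generate_finite _ generateFrom_measurableCylinders.symm
    isPiSystem_measurableCylinders ?_ (by simp)
  intro t ht
  obtain ⟨s, B, hB, rfl⟩ := (mem_measurableCylinders t).1 ht
  have hm : MeasurableSet (cylinder (α := fun _ : ℕ => S) s B) := .of_mem_measurableCylinders ht
  have hk := key (s.sup id) ((cylinder s B).indicator 1) (measurable_one.indicator hm)
  have e : ∀ ω : ℕ → S, (cylinder s B).indicator (1 : (ℕ → S) → ℝ≥0∞) (V (s.sup id) ω)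
      = (cylinder s B).indicator 1 ω := by
    intro ω
    have : V (s.sup id) ω ∈ cylinder s B ↔ ω ∈ cylinder s B := by
      simp only [mem_cylinder]
      have : s.restrict (V (s.sup id) ω) = s.restrict ω := by
        ext ⟨i, hi⟩
        simp only [Finset.restrict, V]
        have hle : i ≤ s.sup id := Finset.le_sup (f := id) hi
        rw [min_eq_left hle]
      rw [this]
    by_cases hω : ω ∈ cylinder s B
    · rw [Set.indicator_of_mem hω, Set.indicator_of_mem (this.2 hω)]; rfl
    · rw [Set.indicator_of_notMem hω, Set.indicator_of_notMem (fun h => hω (this.1 h))]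
  simp_rw [e] at hk
  rwa [lintegral_indicator_one hm, lintegral_indicator_one hm] at hk

/-- shift a block by one step, appending `z`. -/
def blkShift {R : ℕ} (x : Fin (R + 1) → S) (z : S) : Fin (R + 1) → S :=
  Fin.snoc (α := fun _ => S) (Fin.tail x) z

theorem blkShift_last {R : ℕ} (x : Fin (R + 1) → S) (z : S) :
    blkShift x z (Fin.last R) = z := Fin.snoc_last _ _

theorem blkShift_castSucc {R : ℕ} (x : Fin (R + 1) → S) (z : S) (i : Fin R) :
    blkShift x z i.castSucc = x i.succ := Fin.snoc_castSucc _ _ _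

theorem measurable_blkShift {R : ℕ} :
    Measurable (Function.uncurry (blkShift : (Fin (R + 1) → S) → S → _)) := by
  refine measurable_pi_lambda _ fun i => ?_
  refine Fin.lastCases ?_ (fun i => ?_) i
  · simp only [Function.uncurry_def, blkShift_last]; fun_prop
  · simp only [Function.uncurry_def, blkShift_castSucc]; fun_prop

/-- `κr` is the kernel of the block chain associated with `κ`. -/
def IsBlk {R : ℕ} (κ : Kernel S S) (κr : Kernel (Fin (R + 1) → S) (Fin (R + 1) → S)) : Prop :=
  ∀ x, κr x = (κ (x (Fin.last R))).map (blkShift x)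

namespace IsBlk

variable {R : ℕ} {κ : Kernel S S} {κr : Kernel (Fin (R + 1) → S) (Fin (R + 1) → S)}

theorem lint (h : IsBlk κ κr) (x : Fin (R + 1) → S) (g : (Fin (R + 1) → S) → ℝ≥0∞)
    (hg : Measurable g) :
    ∫⁻ y, g y ∂κr x = ∫⁻ z, g (blkShift x z) ∂κ (x (Fin.last R)) := by
  rw [h x, lintegral_map hg]
  exact measurable_blkShift.comp (measurable_const.prodMk measurable_id)

theorem markov [IsMarkovKernel κ] (h : IsBlk κ κr) : IsMarkovKernel κr := by
  refine ⟨fun x => ⟨?_⟩⟩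
  have := h.lint x 1 measurable_one
  simpa using this

theorem last_steps (h : IsBlk κ κr) (n : ℕ) (x : Fin (R + 1) → S) (g : S → ℝ≥0∞)
    (hg : Measurable g) :
    ∫⁻ y, g (y (Fin.last R)) ∂kpow κr n x = ∫⁻ z, g z ∂kpow κ n (x (Fin.last R)) := by
  induction n generalizing x with
  | zero =>
    rw [kpow_zero, kpow_zero, Kernel.id_apply, Kernel.id_apply, lintegral_dirac' _ hg,
      lintegral_dirac' _ (by fun_prop)]
  | succ n ih =>
    rw [kpow_succ, kpow_succ, Kernel.lintegral_comp _ _ _ (by fun_prop),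
      Kernel.lintegral_comp _ _ _ hg]
    simp_rw [ih]
    rw [h.lint x (fun y => ∫⁻ z, g z ∂kpow κ n (y (Fin.last R)))
      (hg.lintegral_kernel.comp (measurable_pi_apply _))]
    simp_rw [blkShift_last]

theorem forget_aux (h : IsBlk κ κr) (j : ℕ) (g : (Fin (R + 1) → S) → ℝ≥0∞)
    (hg : Measurable g)
    (hd : ∀ x x' : Fin (R + 1) → S, (∀ i : Fin (R + 1), R ≤ i + j → x i = x' i) → g x = g x')
    (x x' : Fin (R + 1) → S) (hx : x (Fin.last R) = x' (Fin.last R)) :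
    ∫⁻ y, g y ∂kpow κr j x = ∫⁻ y, g y ∂kpow κr j x' := by
  induction j generalizing g with
  | zero =>
    rw [kpow_zero, Kernel.id_apply, Kernel.id_apply, lintegral_dirac' _ hg,
      lintegral_dirac' _ hg]
    apply hd
    intro i hi
    have : i = Fin.last R := by ext; simp; omega
    rw [this, hx]
  | succ j ih =>
    rw [kpow_succ', Kernel.lintegral_comp _ _ _ hg, Kernel.lintegral_comp _ _ _ hg]
    refine ih _ hg.lintegral_kernel ?_
    intro y y' hy
    rw [h.lint y g hg, h.lint y' g hg, hy (Fin.last R) (by simp)]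
    refine lintegral_congr fun z => hd _ _ ?_
    intro i
    refine Fin.lastCases ?_ (fun i => ?_) i
    · intro _; rw [blkShift_last, blkShift_last]
    · intro hi
      rw [blkShift_castSucc, blkShift_castSucc]
      apply hy
      simp at hi ⊢
      omega

theorem forget (h : IsBlk κ κr) (x x' : Fin (R + 1) → S)
    (hx : x (Fin.last R) = x' (Fin.last R)) : kpow κr R x = kpow κr R x' := by
  refine Measure.ext_of_lintegral _ fun g hg => ?_
  refine h.forget_aux R g hg (fun y y' hy => ?_) x x' hx
  congr 1
  ext i
  exact hy i (by omega)

/-- The law of the block started at `z`. -/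
noncomputable def beta (κr : Kernel (Fin (R + 1) → S) (Fin (R + 1) → S)) :
    Kernel S (Fin (R + 1) → S) :=
  (kpow κr R).comap (fun z _ => z) (by fun_prop)

theorem beta_apply (z : S) : beta κr z = kpow κr R (fun _ => z) := rfl

theorem kpow_R (h : IsBlk κ κr) (x : Fin (R + 1) → S) :
    kpow κr R x = beta κr (x (Fin.last R)) := h.forget _ _ rfl

theorem kpow_R_add (h : IsBlk κ κr) (n : ℕ) (x : Fin (R + 1) → S)
    (g : (Fin (R + 1) → S) → ℝ≥0∞) (hg : Measurable g) :
    ∫⁻ y, g y ∂kpow κr (R + n) x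
      = ∫⁻ z, ∫⁻ y, g y ∂beta κr z ∂kpow κ n (x (Fin.last R)) := by
  rw [kpow_add, Kernel.lintegral_comp _ _ _ hg]
  simp_rw [h.kpow_R]
  exact h.last_steps n x (fun z => ∫⁻ y, g y ∂beta κr z) hg.lintegral_kernel

theorem kpow_R_add_apply (h : IsBlk κ κr) (n : ℕ) (x : Fin (R + 1) → S)
    (A : Set (Fin (R + 1) → S)) (hA : MeasurableSet A) :
    kpow κr (R + n) x A = ∫⁻ z, beta κr z A ∂kpow κ n (x (Fin.last R)) := by
  have := h.kpow_R_add n x (A.indicator 1) (measurable_one.indicator hA)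
  simpa only [lintegral_indicator_one hA] using this

theorem positive [IsMarkovKernel κ] (h : IsBlk κ κr) (π : Measure S)
    (hπprob : IsProbabilityMeasure π) (hπinv : IsInvariantMeasure κ π) : IsPositive κr := by
  have := h.markov
  have := kpow_markov κr R
  have hb : IsMarkovKernel (beta κr) := by unfold beta; infer_instance
  refine ⟨π.bind (beta κr), inferInstance, ?_⟩
  unfold IsInvariantMeasure at hπinv ⊢
  refine Measure.ext_of_lintegral _ fun g hg => ?_
  rw [Measure.lintegral_bind κr.aemeasurable hg.aemeasurable,
    Measure.lintegral_bind (beta κr).aemeasurable hg.lintegral_kernel.aemeasurable,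
    Measure.lintegral_bind (beta κr).aemeasurable hg.aemeasurable]
  conv_rhs => rw [← hπinv]
  rw [Measure.lintegral_bind κ.aemeasurable hg.lintegral_kernel.aemeasurable]
  refine lintegral_congr fun z => ?_
  have := h.kpow_R_add 1 (fun _ => z) g hg
  rw [kpow_succ', Kernel.lintegral_comp _ _ _ hg, kpow_succ, kpow_zero, Kernel.id_comp] at this
  exact this

/-- The law of the first `R + 1` coordinates under a Markov law started at `z`. -/
theorem window [IsMarkovKernel κ] [MeasurableSingletonClass S]
    (h : IsBlk κ κr) {P : Measure (ℕ → S)} [IsProbabilityMeasure P] (hP : IsMk κ P) (z : S)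
    (hP0 : ∀ᵐ ω ∂P, ω 0 = z) (n : ℕ) (g : (Fin (R + 1) → S) → ℝ≥0∞) (hg : Measurable g) :
    ∫⁻ ω, g (fun i => ω (i + n - R)) ∂P = ∫⁻ y, g y ∂kpow κr n (fun _ => z) := by
  induction n generalizing g with
  | zero =>
    rw [kpow_zero, Kernel.id_apply, lintegral_dirac' _ hg]
    have e1 : ∫⁻ ω, g (fun i => ω (i + 0 - R)) ∂P = ∫⁻ _, g (fun _ => z) ∂P := by
      apply lintegral_congr_ae
      filter_upwards [hP0] with ω hω
      congr 1
      ext i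
      rw [← hω]
      congr 1
      omega
    rw [e1]; simp
  | succ n ih =>
    let V : (ℕ → S) → (Fin (R + 1) → S) := fun ω i => ω (i + n - R)
    have hV : Measurable[past S n] V :=
      @measurable_pi_lambda _ _ _ (past S n) _ _ fun i => past_eval (by omega)
    have e : ∀ ω : ℕ → S, (fun i : Fin (R + 1) => ω (i + (n + 1) - R))
        = blkShift (V ω) (ω (n + 1)) := by
      intro ω
      ext i
      refine Fin.lastCases ?_ (fun i => ?_) i
      · rw [blkShift_last]; congr 1; simp
      · rw [blkShift_castSucc]; simp only [V]; congr 1; simp; omega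
    simp_rw [e]
    have hj := hP.joint n V hV (fun v s => g (blkShift v s)) (hg.comp measurable_blkShift)
    rw [hj, kpow_succ', Kernel.lintegral_comp _ _ _ hg, ← ih _ hg.lintegral_kernel]
    refine lintegral_congr fun ω => ?_
    rw [h.lint _ g hg]
    have : ((Fin.last R : ℕ) + n - R) = n := by simp
    rw [this]

theorem window_R [IsMarkovKernel κ] [MeasurableSingletonClass S]
    (h : IsBlk κ κr) {P : Measure (ℕ → S)} [IsProbabilityMeasure P] (hP : IsMk κ P) (z : S)
    (hP0 : ∀ᵐ ω ∂P, ω 0 = z) (A : Set (Fin (R + 1) → S)) (hA : MeasurableSet A) :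
    P {ω | Fin.cons (α := fun _ => S) z (fun i : Fin R => ω ((i : ℕ) + 1)) ∈ A}
      = beta κr z A := by
  have hw := h.window hP z hP0 R (A.indicator 1) (measurable_one.indicator hA)
  rw [lintegral_indicator_one hA] at hw
  rw [beta_apply, ← hw]
  have hm : Measurable (fun ω : ℕ → S => (fun i : Fin (R + 1) => ω ((i : ℕ) + R - R))) := by
    fun_prop
  have e4 : (fun ω : ℕ → S => A.indicator (1 : (Fin (R + 1) → S) → ℝ≥0∞) (fun i => ω ((i : ℕ) + R - R)))
      = ((fun ω : ℕ → S => (fun i : Fin (R + 1) => ω ((i : ℕ) + R - R))) ⁻¹' A).indicator 1 := rfl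
  rw [e4, lintegral_indicator_one (hm hA)]
  apply measure_congr
  filter_upwards [hP0] with ω hω
  have : (Fin.cons (α := fun _ => S) z (fun i : Fin R => ω ((i : ℕ) + 1)))
      = (fun i : Fin (R + 1) => ω ((i : ℕ) + R - R)) := by
    ext i
    refine Fin.cases ?_ (fun i => ?_) i
    · simp [hω]
    · simp
  apply propext
  change _ ∈ A ↔ _ ∈ A
  rw [this]

end IsBlk

theorem meas_start [MeasurableSingletonClass S] (z : S) :
    MeasurableSet {ω : ℕ → S | ω 0 = z} := by
  have hm : Measurable (fun ω : ℕ → S => ω 0) := measurable_pi_apply 0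
  exact hm (measurableSet_singleton z)

theorem ae_start [MeasurableSingletonClass S] {κ : Kernel S S} {Pz : S → Measure (ℕ → S)}
    (h : IsMarkovFamily κ Pz) (z : S) : ∀ᵐ ω ∂Pz z, ω 0 = z := by
  have := h.1 z
  exact (prob_compl_eq_zero_iff (meas_start z)).2 (h.2.1 z)

/-- Lévy zero-one law argument: if `C` is visited infinitely often and from `C` the set `A` is
reached in `R` steps with probability more than `ε`, then `A` is visited infinitely often. -/
theorem IsMk.io {κ : Kernel S S} [IsMarkovKernel κ] {Q : Measure (ℕ → S)}
    [IsProbabilityMeasure Q] (hQ : IsMk κ Q) (R : ℕ) (A C : Set S) (hA : MeasurableSet A)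
    (ε : ℝ≥0∞) (hε : 0 < ε) (hC : ∀ z ∈ C, ε ≤ kpow κ R z A)
    (hio : ∀ᵐ ω ∂Q, ∀ N : ℕ, ∃ k : ℕ, N ≤ k ∧ ω k ∈ C) :
    ∀ᵐ ω ∂Q, ∀ N : ℕ, ∃ k : ℕ, N ≤ k ∧ ω k ∈ A := by
  have hMk := kpow_markov κ R
  rw [ae_all_iff]
  intro N
  let ℱ : Filtration ℕ (inferInstance : MeasurableSpace (ℕ → S)) :=
    ⟨past S, fun _ _ h => past_mono h, past_le⟩
  let U : Set (ℕ → S) := {ω | ∃ k, N ≤ k ∧ ω k ∈ A}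
  have hUeq : U = ⋃ k : ℕ, ⋃ _ : N ≤ k, (fun ω : ℕ → S => ω k) ⁻¹' A := by
    ext ω; simp [U]
  have hU : MeasurableSet[⨆ n, ℱ n] U := by
    rw [hUeq]
    refine MeasurableSet.iUnion fun k => MeasurableSet.iUnion fun _ => ?_
    exact le_iSup (fun n => (ℱ n : MeasurableSpace (ℕ → S))) k _ (past_eval (le_refl k) hA)
  have hU' : MeasurableSet U := (iSup_le fun n => ℱ.le n) U hU
  let f : (ℕ → S) → ℝ := U.indicator 1
  have hfi : Integrable f Q := (integrable_const (1 : ℝ)).indicator hU'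
  have hlim := hfi.tendsto_ae_condExp (ℱ := ℱ)
    (stronglyMeasurable_one.indicator hU)
  have hlow : ∀ n, N ≤ n → ∀ᵐ ω ∂Q, (kpow κ R (ω n) A).toReal ≤ (Q[f | ℱ n]) ω := by
    intro n hn
    let e : (ℕ → S) → ℝ := fun ω => (A.indicator (1 : S → ℝ≥0∞) (ω (n + R))).toReal
    have hem : Measurable (fun ω : ℕ → S => A.indicator (1 : S → ℝ≥0∞) (ω (n + R))) :=
      (measurable_one.indicator hA).comp (measurable_pi_apply _)
    have hele : ∀ ω : ℕ → S, A.indicator (1 : S → ℝ≥0∞) (ω (n + R)) ≤ 1 := fun ω =>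
      Set.indicator_le_self' (by simp) _
    have hgm0 : Measurable (fun z : S => kpow κ R z A) := Kernel.measurable_coe _ hA
    have hgm : Measurable[past S n] (fun ω : ℕ → S => kpow κ R (ω n) A) :=
      hgm0.comp (past_eval (le_refl n))
    have hgm' : Measurable (fun ω : ℕ → S => kpow κ R (ω n) A) :=
      hgm0.comp (measurable_pi_apply n)
    have hei : Integrable e Q := by
      refine Integrable.of_bound hem.ennreal_toReal.aestronglyMeasurable 1 (.of_forall fun ω => ?_)
      rw [Real.norm_of_nonneg ENNReal.toReal_nonneg]
      exact ENNReal.toReal_mono ENNReal.one_ne_top (hele ω)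
    have hgi : Integrable (fun ω : ℕ → S => (kpow κ R (ω n) A).toReal) Q := by
      refine Integrable.of_bound hgm'.ennreal_toReal.aestronglyMeasurable 1
        (.of_forall fun ω => ?_)
      rw [Real.norm_of_nonneg ENNReal.toReal_nonneg]
      exact ENNReal.toReal_mono ENNReal.one_ne_top prob_le_one
    have hce : (fun ω : ℕ → S => (kpow κ R (ω n) A).toReal) =ᵐ[Q] Q[e | ℱ n] := by
      refine ae_eq_condExp_of_forall_setIntegral_eq (ℱ.le n) hei
        (fun s _ _ => hgi.integrableOn) (fun s hs _ => ?_) ?_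
      · rw [integral_toReal hgm'.aemeasurable (.of_forall fun ω => measure_lt_top _ _),
          integral_toReal hem.aemeasurable
            (.of_forall fun ω => (hele ω).trans_lt ENNReal.one_lt_top)]
        have := hQ.steps n R (A.indicator 1) (measurable_one.indicator hA) s hs
        simp only [lintegral_indicator_one hA] at this
        rw [this]
      · exact (Measurable.stronglyMeasurable
          (@Measurable.ennreal_toReal _ (past S n) _ hgm)).aestronglyMeasurable
    have hmono : Q[e | ℱ n] ≤ᵐ[Q] Q[f | ℱ n] := by
      refine condExp_mono hei hfi (.of_forall fun ω => ?_)
      by_cases hω : ω (n + R) ∈ A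
      · have : ω ∈ U := ⟨n + R, by omega, hω⟩
        simp [e, f, hω, this]
      · simp only [e, f, Set.indicator_of_notMem hω, ENNReal.toReal_zero]
        exact Set.indicator_nonneg (by simp) _
    filter_upwards [hce, hmono] with ω h1 h2
    exact h1.le.trans h2
  have hlow' : ∀ᵐ ω ∂Q, ∀ n, N ≤ n → (kpow κ R (ω n) A).toReal ≤ (Q[f | ℱ n]) ω := by
    rw [ae_all_iff]
    intro n
    by_cases hn : N ≤ n
    · filter_upwards [hlow n hn] with ω h _ using h
    · exact .of_forall fun ω h => absurd h hn
  filter_upwards [hlim, hlow', hio] with ω h1 h2 h3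
  by_contra hcon
  have hf0 : f ω = 0 := Set.indicator_of_notMem (s := U) hcon _
  rw [hf0] at h1
  have hε' : ε ≠ ∞ := by
    obtain ⟨k, _, hk⟩ := h3 0
    exact ((hC _ hk).trans_lt (measure_lt_top _ _)).ne
  have hev := h1.eventually (gt_mem_nhds (ENNReal.toReal_pos hε.ne' hε'))
  obtain ⟨M, hM⟩ := Filter.eventually_atTop.1 hev
  obtain ⟨k, hk, hkC⟩ := h3 (max M N)
  have a1 := hM k (le_trans (le_max_left _ _) hk)
  have a2 := h2 k (le_trans (le_max_right _ _) hk)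
  have a3 := ENNReal.toReal_mono (measure_ne_top _ _) (hC _ hkC)
  linarith

namespace IsBlk

variable {R : ℕ} {κ : Kernel S S} {κr : Kernel (Fin (R + 1) → S) (Fin (R + 1) → S)}

/-- The last coordinate of the block chain is a Markov chain with kernel `κ`. -/
theorem isMk_last (h : IsBlk κ κr) {Q : Measure (ℕ → Fin (R + 1) → S)} (hQ : IsMk κr Q) :
    IsMk κ (Q.map (fun ω k => ω k (Fin.last R))) := by
  intro n g hg C hC
  have hL : Measurable (fun (ω : ℕ → Fin (R + 1) → S) (k : ℕ) => ω k (Fin.last R)) := by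
    fun_prop
  have hLn : Measurable[past (Fin (R + 1) → S) n, past S n]
      (fun (ω : ℕ → Fin (R + 1) → S) (k : ℕ) => ω k (Fin.last R)) := by
    rw [measurable_iff_comap_le, past, MeasurableSpace.comap_iSup]
    refine iSup_le fun i => ?_
    rw [MeasurableSpace.comap_iSup]
    refine iSup_le fun hi => ?_
    rw [MeasurableSpace.comap_comp, ← measurable_iff_comap_le]
    exact (measurable_pi_apply (Fin.last R)).comp (past_eval hi)
  have hC' : MeasurableSet C := past_le n C hC
  have hk : Measurable fun ω : ℕ → S => ∫⁻ z', g z' ∂(κ (ω n)) :=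
    hg.lintegral_kernel.comp (measurable_pi_apply n)
  have hg1 : Measurable fun ω : ℕ → S => g (ω (n + 1)) := hg.comp (measurable_pi_apply (n + 1))
  rw [setLIntegral_map hC' hg1 hL, setLIntegral_map hC' hk hL,
    hQ n (fun y => g (y (Fin.last R))) (by fun_prop) _ (hLn hC)]
  refine lintegral_congr fun ω => ?_
  rw [h.lint _ _ (by fun_prop)]
  simp_rw [blkShift_last]

theorem psir_eq [IsMarkovKernel κ] [MeasurableSingletonClass S] (h : IsBlk κ κr)
    {Pz : S → Measure (ℕ → S)} (hFam : IsMarkovFamily κ Pz) (ψ : Measure S) [SigmaFinite ψ]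
    (A : Set (Fin (R + 1) → S)) (hA : MeasurableSet A) :
    ∫⁻ z₁ in proj1 A,
        Pz z₁ {ω | Fin.cons (α := fun _ => S) z₁ (fun i : Fin R => ω ((i : ℕ) + 1)) ∈ A} ∂ψ
      = ∫⁻ z, beta κr z A ∂ψ := by
  have e : ∀ z, Pz z {ω | Fin.cons (α := fun _ => S) z (fun i : Fin R => ω ((i : ℕ) + 1)) ∈ A}
      = beta κr z A := fun z => by
    have := hFam.1 z
    exact h.window_R (hFam.isMk z) z (ae_start hFam z) A hA
  have e0 : ∀ z, z ∉ proj1 A → beta κr z A = 0 := by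
    intro z hz
    rw [← e z]
    have : {ω : ℕ → S | Fin.cons (α := fun _ => S) z (fun i : Fin R => ω ((i : ℕ) + 1)) ∈ A}
        = ∅ := by
      ext ω
      simp only [Set.mem_setOf_eq, Set.mem_empty_iff_false, iff_false]
      intro hmem
      exact hz ⟨_, hmem, rfl⟩
    rw [this, measure_empty]
  simp_rw [e]
  rw [← Measure.restrict_toMeasurable_of_sFinite (proj1 A)]
  rw [← lintegral_indicator (measurableSet_toMeasurable _ _)]
  refine lintegral_congr fun z => ?_
  by_cases hz : z ∈ toMeasurable ψ (proj1 A)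
  · rw [Set.indicator_of_mem hz]
  · rw [Set.indicator_of_notMem hz, e0 z fun h' => hz (subset_toMeasurable _ _ h')]

theorem main [IsMarkovKernel κ] [MeasurableSingletonClass S] (h : IsBlk κ κr)
    (Pz : S → Measure (ℕ → S)) (ψ π : Measure S)
    (hFam : IsMarkovFamily κ Pz)
    (hmax : IsMaxIrreducibilityMeasure κ ψ)
    (hHarris : HarrisProp κ Pz ψ)
    (hπprob : IsProbabilityMeasure π) (hπinv : IsInvariantMeasure κ π)
    (Pzr : (Fin (R + 1) → S) → Measure (ℕ → Fin (R + 1) → S))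
    (hFamr : IsMarkovFamily κr Pzr)
    (ψr : Measure (Fin (R + 1) → S))
    (hψr : ∀ A : Set (Fin (R + 1) → S), MeasurableSet A →
      ψr A = ∫⁻ z₁ in proj1 A,
        Pz z₁ {ω | Fin.cons (α := fun _ => S) z₁ (fun i : Fin R => ω ((i : ℕ) + 1)) ∈ A} ∂ψ) :
    IsPositive κr ∧ IsMaxIrreducibilityMeasure κr ψr ∧ HarrisProp κr Pzr ψr := by
  obtain ⟨hσ, hirr, hdom⟩ := hmax
  have hMkr := h.markov
  have hψr' : ∀ A : Set (Fin (R + 1) → S), MeasurableSet A → ψr A = ∫⁻ z, beta κr z A ∂ψ :=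
    fun A hA => (hψr A hA).trans (h.psir_eq hFam ψ A hA)
  have hbm : ∀ A : Set (Fin (R + 1) → S), MeasurableSet A →
      Measurable (fun z => beta κr z A) := fun A hA => Kernel.measurable_coe _ hA
  have hpos : ∀ (ν : Measure S) (A : Set (Fin (R + 1) → S)), MeasurableSet A →
      (0 < ∫⁻ z, beta κr z A ∂ν ↔ 0 < ν {z | beta κr z A ≠ 0}) := fun ν A hA =>
    lintegral_pos_iff_support (hbm A hA)
  have hNm : ∀ A : Set (Fin (R + 1) → S), MeasurableSet A →
      MeasurableSet {z | beta κr z A ≠ 0} := fun A hA =>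
    (hbm A hA (measurableSet_singleton 0)).compl
  refine ⟨h.positive π hπprob hπinv, ⟨?_, ?_, ?_⟩, ?_⟩
  · have : ψr.map (fun x => x 0) = ψ := by
      ext C hC
      have hm : MeasurableSet ((fun x : Fin (R + 1) → S => x 0) ⁻¹' C) :=
        measurable_pi_apply 0 hC
      rw [Measure.map_apply (measurable_pi_apply 0) hC, hψr _ hm]
      have e : proj1 ((fun x : Fin (R + 1) → S => x 0) ⁻¹' C) = C := by
        ext z
        constructor
        · rintro ⟨x, hx, rfl⟩; exact hx
        · intro hz; exact ⟨fun _ => z, hz, rfl⟩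
      rw [e, setLIntegral_congr_fun (g := fun _ => 1) hC]
      · simp
      · intro z hz
        have := hFam.1 z
        simp [hz]
    refine SigmaFinite.of_map ψr (measurable_pi_apply 0).aemeasurable ?_
    rw [this]; exact hσ
  · intro A hA hAp x
    rw [hψr' A hA, hpos _ A hA] at hAp
    obtain ⟨k, hk, hkp⟩ := hirr _ (hNm A hA) hAp (x (Fin.last R))
    refine ⟨R + k, by omega, ?_⟩
    rw [h.kpow_R_add_apply k x A hA, hpos _ A hA]
    exact hkp
  · intro φ hφσ hφ
    refine Measure.AbsolutelyContinuous.mk fun A hA hA0 => ?_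
    rw [hψr' A hA] at hA0
    by_contra hφA
    have hφA' : 0 < φ A := pos_iff_ne_zero.2 hφA
    -- every point reaches `A` after at least `R` steps
    have hreach : ∀ x, ∃ m, kpow κr (R + m) x A ≠ 0 := by
      intro x
      have := kpow_markov κr R
      by_contra! hall
      have hz : ∀ m, ∀ᵐ y ∂kpow κr R x, kpow κr m y A = 0 := by
        intro m
        have h1 := hall m
        rw [Nat.add_comm R m, kpow_add, Kernel.comp_apply' _ _ _ hA] at h1
        exact (lintegral_eq_zero_iff (Kernel.measurable_coe _ hA)).1 h1
      rw [← ae_all_iff] at hz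
      obtain ⟨y, hy⟩ := hz.exists
      obtain ⟨k, _, hk⟩ := hφ A hA hφA' y
      exact hk.ne' (hy k)
    have hun : φ (⋃ m, {x | kpow κr (R + m) x A ≠ 0}) ≠ 0 := by
      have : (⋃ m, {x | kpow κr (R + m) x A ≠ 0}) = Set.univ := by
        ext x; simpa using hreach x
      rw [this]
      exact fun h0 => hφA (measure_mono_null (Set.subset_univ A) h0)
    obtain ⟨m, hm⟩ := exists_measure_pos_of_not_measure_iUnion_null hun
    have hmk := kpow_markov κ m
    let φ' : Measure S := (φ.toFinite.map (fun x => x (Fin.last R))).bind (kpow κ m)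
    have hφ'app : ∀ D, MeasurableSet D →
        φ' D = ∫⁻ x, kpow κ m (x (Fin.last R)) D ∂φ.toFinite := by
      intro D hD
      rw [Measure.bind_apply hD (Kernel.aemeasurable _),
        lintegral_map (Kernel.measurable_coe _ hD) (measurable_pi_apply _)]
    have hφ'pos : ∀ D, MeasurableSet D →
        (φ' D ≠ 0 ↔ φ {x | kpow κ m (x (Fin.last R)) D ≠ 0} ≠ 0) := by
      intro D hD
      have hmm : Measurable fun x : Fin (R + 1) → S => kpow κ m (x (Fin.last R)) D :=
        (Kernel.measurable_coe _ hD).comp (measurable_pi_apply _)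
      rw [hφ'app D hD, ← pos_iff_ne_zero, lintegral_pos_iff_support hmm, pos_iff_ne_zero]
      refine not_congr ⟨fun h0 => absolutelyContinuous_toFinite φ h0,
        fun h0 => toFinite_absolutelyContinuous φ h0⟩
    have hφ'irr : IsIrreducibilityMeasure κ φ' := by
      intro D hD hDp z
      have h1 := (hφ'pos D hD).1 hDp.ne'
      have hDm : MeasurableSet {z | kpow κ m z D ≠ 0} :=
        (Kernel.measurable_coe (kpow κ m) hD (measurableSet_singleton 0)).compl
      obtain ⟨k, hk, hkp⟩ := hφ ((fun x => x (Fin.last R)) ⁻¹' {z | kpow κ m z D ≠ 0})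
        (measurable_pi_apply _ hDm) (pos_iff_ne_zero.2 h1) (fun _ => z)
      refine ⟨m + k, by omega, ?_⟩
      rw [kpow_add, Kernel.comp_apply' _ _ _ hD,
        lintegral_pos_iff_support (Kernel.measurable_coe _ hD)]
      have h2 := h.last_steps k (fun _ => z) ({z | kpow κ m z D ≠ 0}.indicator 1)
        (measurable_one.indicator hDm)
      rw [lintegral_indicator_one hDm] at h2
      change 0 < kpow κ k z {z | kpow κ m z D ≠ 0}
      rw [← h2]
      have e : (fun y : Fin (R + 1) → S =>
          {z | kpow κ m z D ≠ 0}.indicator (1 : S → ℝ≥0∞) (y (Fin.last R)))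
          = ((fun x : Fin (R + 1) → S => x (Fin.last R)) ⁻¹'
            {z | kpow κ m z D ≠ 0}).indicator 1 := rfl
      rw [e, lintegral_indicator_one (measurable_pi_apply _ hDm)]
      exact hkp
    have hac := hdom φ' inferInstance hφ'irr
    have hψN : ψ {z | beta κr z A ≠ 0} = 0 := by
      by_contra hne
      exact ((hpos ψ A hA).2 (pos_iff_ne_zero.2 hne)).ne' hA0
    refine (hφ'pos _ (hNm A hA)).2 ?_ (hac hψN)
    have e : {x : Fin (R + 1) → S | kpow κ m (x (Fin.last R)) {z | beta κr z A ≠ 0} ≠ 0}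
        = {x | kpow κr (R + m) x A ≠ 0} := by
      ext x
      simp only [Set.mem_setOf_eq]
      rw [h.kpow_R_add_apply m x A hA, ← pos_iff_ne_zero, ← pos_iff_ne_zero, hpos _ A hA]
    rw [e]
    exact hm.ne'
  · intro A hA hAp x
    have hpx := hFamr.1 x
    rw [hψr' A hA, hpos _ A hA] at hAp
    have hsub : {z | beta κr z A ≠ 0} ⊆ ⋃ n : ℕ, {z | ((n : ℝ≥0∞) + 1)⁻¹ ≤ beta κr z A} := by
      intro z hz
      obtain ⟨n, hn⟩ := ENNReal.exists_inv_nat_lt hz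
      refine Set.mem_iUnion.2 ⟨n, ?_⟩
      exact le_trans (ENNReal.inv_le_inv.2 le_self_add) hn.le
    obtain ⟨n, hn⟩ := exists_measure_pos_of_not_measure_iUnion_null
      (fun h0 => hAp.ne' (measure_mono_null hsub h0))
    set C : Set S := {z | ((n : ℝ≥0∞) + 1)⁻¹ ≤ beta κr z A} with hCdef
    have hCm : MeasurableSet C := measurableSet_le measurable_const (hbm A hA)
    have hL : Measurable (fun (ω : ℕ → Fin (R + 1) → S) (k : ℕ) => ω k (Fin.last R)) := by
      fun_prop
    have hpz := hFam.1 (x (Fin.last R))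
    have hpl : IsProbabilityMeasure ((Pzr x).map (fun ω k => ω k (Fin.last R))) :=
      Measure.isProbabilityMeasure_map hL.aemeasurable
    have heq : (Pzr x).map (fun ω k => ω k (Fin.last R)) = Pz (x (Fin.last R)) := by
      refine IsMk.unique (h.isMk_last (hFamr.isMk x)) (hFam.isMk _) (x (Fin.last R)) ?_
        (ae_start hFam _)
      rw [ae_map_iff hL.aemeasurable (meas_start _)]
      filter_upwards [ae_start hFamr x] with ω hω
      rw [hω]
    have hio : ∀ (T : Type _) [MeasurableSpace T] (B : Set T), MeasurableSet B →
        MeasurableSet {ω : ℕ → T | ∀ N : ℕ, ∃ k : ℕ, N ≤ k ∧ ω k ∈ B} := by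
      intro T _ B hB
      have : {ω : ℕ → T | ∀ N : ℕ, ∃ k : ℕ, N ≤ k ∧ ω k ∈ B}
          = ⋂ N : ℕ, ⋃ k : ℕ, ⋃ _ : N ≤ k, (fun ω : ℕ → T => ω k) ⁻¹' B := by
        ext ω; simp
      rw [this]
      exact MeasurableSet.iInter fun N => MeasurableSet.iUnion fun k =>
        MeasurableSet.iUnion fun _ => measurable_pi_apply k hB
    have h1 := hHarris C hCm hn (x (Fin.last R))
    have h2 : ∀ᵐ ω ∂Pz (x (Fin.last R)), ∀ N : ℕ, ∃ k : ℕ, N ≤ k ∧ ω k ∈ C :=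
      (prob_compl_eq_zero_iff (hio S C hCm)).2 h1
    rw [← heq, ae_map_iff hL.aemeasurable (hio S C hCm)] at h2
    have h3 := (hFamr.isMk x).io R A {y | y (Fin.last R) ∈ C} hA ((n : ℝ≥0∞) + 1)⁻¹
      (by simp) (fun y hy => by rw [h.kpow_R]; exact hy) h2
    exact (prob_compl_eq_zero_iff (hio _ A hA)).1 h3

end IsBlk

end Aux


/-- If `Z` is a positive Harris chain on `𝓧 × 𝓨` with stationary probability
measure `π` and maximal irreducibility measure `ψ`, then the overlapping `r`-block process
(`r = R + 1 > 1`), a Markov chain with kernel `κr`, is positive Harris and its maximal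
irreducibility measure is `ψ_r` given by
`ψ_r(A) = ∫_{A_(1)} P(Z_{2:r} ∈ A(z₁) | Z₁ = z₁) ψ(dz₁)`. -/
theorem block_process_positive_harris
    [TopologicalSpace 𝓧] [PolishSpace 𝓧] [BorelSpace 𝓧]
    (κ : Kernel (𝓧 × 𝓨) (𝓧 × 𝓨)) [IsMarkovKernel κ]
    (Pz : 𝓧 × 𝓨 → Measure (ℕ → 𝓧 × 𝓨)) (ψ π : Measure (𝓧 × 𝓨))
    (hFam : IsMarkovFamily κ Pz)
    (hmax : IsMaxIrreducibilityMeasure κ ψ)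
    (hHarris : HarrisProp κ Pz ψ)
    (hπprob : IsProbabilityMeasure π) (hπinv : IsInvariantMeasure κ π)
    (R : ℕ) (hR : 1 ≤ R)
    (κr : Kernel (Fin (R + 1) → 𝓧 × 𝓨) (Fin (R + 1) → 𝓧 × 𝓨))
    (hκr : ∀ x : Fin (R + 1) → 𝓧 × 𝓨,
      (κr x : Measure (Fin (R + 1) → 𝓧 × 𝓨)) =
        (κ (x (Fin.last R))).map (fun z' => Fin.snoc (Fin.tail x) z'))
    (Pzr : (Fin (R + 1) → 𝓧 × 𝓨) → Measure (ℕ → Fin (R + 1) → 𝓧 × 𝓨))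
    (hFamr : IsMarkovFamily κr Pzr)
    (ψr : Measure (Fin (R + 1) → 𝓧 × 𝓨))
    (hψr : ∀ A : Set (Fin (R + 1) → 𝓧 × 𝓨), MeasurableSet A →
      ψr A = ∫⁻ z₁ in proj1 A,
        Pz z₁ {ω | Fin.cons z₁ (fun i : Fin R => ω ((i : ℕ) + 1)) ∈ A} ∂ψ) :
    IsPositive κr ∧ IsMaxIrreducibilityMeasure κr ψr ∧ HarrisProp κr Pzr ψr := by
  exact IsBlk.main (κ := κ) (κr := κr) hκr Pz ψ π hFam hmax hHarris hπprob hπinv Pzr hFamr ψr hψr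

end PMMPaper
end

section
/- Suppose the PMM Z satisfies assumption A1 with set E ⊂ X^r. Let n ≥ t ≥ s ≥ l ≥ 1 and m ≥ 1, and set ρ = 1 − n₀^{-2}, where n₀ satisfies 1/n₀ ≤ p_{ij}(x_{1:r}) ≤ n₀ for all (i,j) ∈ Y⁺ and x_{1:r} ∈ E. Then for every k = 0,…,r'−1 (with r' = r−1), almost surely ‖ν^t_{l:n;m} − ν^t_{s:n;m}‖_TV ≤ 2 ρ^{κ_k(X_{s:t})}. Moreover the same inequality holds with κ_k(X_{s:t}) replaced by the backward counter κ̄(X_{s:t}). -/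
open MeasureTheory ProbabilityTheory ENNReal

namespace PMMPaper

/-! ### Pairwise Markov models -/

variable {𝓧 : Type*} [MeasurableSpace 𝓧] {𝓨 : Type*} [Fintype 𝓨] [DecidableEq 𝓨]
  [MeasurableSpace 𝓨] [MeasurableSingletonClass 𝓨] [Nonempty 𝓨]
  {Ω : Type*} [MeasurableSpace Ω]

/-! ### Deterministic part: contraction of normalized smoothing vectors -/

/-- `ContrBd b C`: any two weight vectors with the same total mass `c < ∞` give smoothing
vectors at distance at most `C * c`. -/
def ContrBd {V W : Type*} [Fintype V] [Fintype W] (b : V → W → ℝ≥0∞) (C : ℝ) : Prop :=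
  ∀ (c : ℝ≥0∞) (γ γ' : W → ℝ≥0∞), c ≠ ∞ → ∑ j, γ j * ∑ v, b v j = c →
    ∑ j, γ' j * ∑ v, b v j = c →
    ∑ v, |(∑ j, γ j * b v j).toReal - (∑ j, γ' j * b v j).toReal| ≤ C * c.toReal

theorem sum_swap_mass {V W : Type*} [Fintype V] [Fintype W] (b : V → W → ℝ≥0∞) (γ : W → ℝ≥0∞) :
    ∑ j, γ j * ∑ v, b v j = ∑ v, ∑ j, γ j * b v j := by
  simp_rw [Finset.mul_sum]
  exact Finset.sum_comm

theorem contrBd_two {V W : Type*} [Fintype V] [Fintype W] (b : V → W → ℝ≥0∞) :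
    ContrBd b 2 := by
  intro c γ γ' hc h h'
  rw [sum_swap_mass] at h h'
  have e1 : ∑ v, (∑ j, γ j * b v j).toReal = c.toReal := by
    rw [← h, ENNReal.toReal_sum]
    intro v _ hv
    exact hc (h ▸ ENNReal.sum_eq_top.2 ⟨v, Finset.mem_univ _, hv⟩)
  have e2 : ∑ v, (∑ j, γ' j * b v j).toReal = c.toReal := by
    rw [← h', ENNReal.toReal_sum]
    intro v _ hv
    exact hc (h' ▸ ENNReal.sum_eq_top.2 ⟨v, Finset.mem_univ _, hv⟩)
  calc _ ≤ ∑ v, ((∑ j, γ j * b v j).toReal + (∑ j, γ' j * b v j).toReal) := by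
        refine Finset.sum_le_sum fun v _ => ?_
        have h1 := ENNReal.toReal_nonneg (a := ∑ j, γ j * b v j)
        have h2 := ENNReal.toReal_nonneg (a := ∑ j, γ' j * b v j)
        rw [abs_le]; constructor <;> linarith
    _ = 2 * c.toReal := by rw [Finset.sum_add_distrib, e1, e2]; ring

theorem contrBd_push {V W : Type*} [Fintype V] [Fintype W] (b b' : V → W → ℝ≥0∞)
    (M : W → W → ℝ≥0∞) (hb : ∀ v i, b v i = ∑ j, M i j * b' v j) {C : ℝ} (h : ContrBd b' C) :
    ContrBd b C := by
  have key : ∀ (α : W → ℝ≥0∞) v, ∑ i, α i * b v i = ∑ j, (∑ i, α i * M i j) * b' v j := by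
    intro α v
    simp_rw [hb, Finset.mul_sum, Finset.sum_mul]
    rw [Finset.sum_comm]
    simp_rw [mul_assoc]
  intro c α α' hc h1 h2
  rw [sum_swap_mass] at h1 h2
  simp_rw [key] at h1 h2 ⊢
  rw [← sum_swap_mass] at h1 h2
  exact h c _ _ hc h1 h2

theorem doeblin_split {W : Type*} [Fintype W] (β : W → ℝ≥0∞)
    (M : W → W → ℝ≥0∞) (Yp : Set (W × W)) (hprod : Yp = (Prod.fst '' Yp) ×ˢ (Prod.snd '' Yp))
    (n₀ : ℕ) (hn₀ : 1 ≤ n₀)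
    (hM : ∀ p ∈ Yp, (n₀ : ℝ≥0∞)⁻¹ ≤ M p.1 p.2 ∧ M p.1 p.2 ≤ n₀)
    (hM0 : ∀ p ∉ Yp, M p.1 p.2 = 0)
    (c : ℝ≥0∞) (hc : c ≠ ∞) (hc0 : c ≠ 0) (α : W → ℝ≥0∞)
    (h : ∑ j, (∑ i, α i * M i j) * β j = c) :
    let S := ∑ j, (Prod.snd '' Yp).indicator β j
    S ≠ 0 ∧ S ≠ ∞ ∧ ∀ j ∈ (Prod.snd '' Yp), c / ((n₀ : ℝ≥0∞) ^ 2 * S) ≤ ∑ i, α i * M i j := by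
  classical
  intro S
  have hn0 : (n₀ : ℝ≥0∞) ≠ 0 := by simp; omega
  have hnt : (n₀ : ℝ≥0∞) ≠ ∞ := by simp
  set Y1 := Prod.fst '' Yp
  set Y2 := Prod.snd '' Yp
  have hmem : ∀ i j, (i, j) ∈ Yp ↔ i ∈ Y1 ∧ j ∈ Y2 := by
    intro i j; rw [hprod]; exact Set.mem_prod
  set a := ∑ i, Y1.indicator α i with ha
  have lo : ∀ j ∈ Y2, a * (n₀ : ℝ≥0∞)⁻¹ ≤ ∑ i, α i * M i j := by
    intro j hj
    rw [ha, Finset.sum_mul]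
    refine Finset.sum_le_sum fun i _ => ?_
    by_cases hi : i ∈ Y1
    · rw [Set.indicator_of_mem hi]
      gcongr
      exact (hM (i, j) ((hmem i j).2 ⟨hi, hj⟩)).1
    · simp [hi]
  have hi : ∀ j, ∑ i, α i * M i j ≤ a * n₀ := by
    intro j
    rw [ha, Finset.sum_mul]
    refine Finset.sum_le_sum fun i _ => ?_
    by_cases hij : (i, j) ∈ Yp
    · rw [Set.indicator_of_mem ((hmem i j).1 hij).1]
      gcongr
      exact (hM _ hij).2
    · rw [hM0 (i, j) hij]; simp
  have hz : ∀ j ∉ Y2, ∑ i, α i * M i j = 0 := by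
    intro j hj
    refine Finset.sum_eq_zero fun i _ => ?_
    rw [hM0 (i, j) (fun hh => hj ((hmem i j).1 hh).2), mul_zero]
  have cup : c ≤ a * n₀ * S := by
    rw [← h, Finset.mul_sum]
    refine Finset.sum_le_sum fun j _ => ?_
    by_cases hj : j ∈ Y2
    · rw [Set.indicator_of_mem hj]
      gcongr
      exact hi j
    · simp [hz j hj]
  have clo : a * (n₀ : ℝ≥0∞)⁻¹ * S ≤ c := by
    rw [← h, Finset.mul_sum]
    refine Finset.sum_le_sum fun j _ => ?_
    by_cases hj : j ∈ Y2
    · rw [Set.indicator_of_mem hj]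
      gcongr
      exact lo j hj
    · rw [Set.indicator_of_notMem hj, mul_zero]; exact zero_le
  have hS0 : S ≠ 0 := by
    intro h0; rw [h0] at cup; simp at cup; exact hc0 cup
  have ha0 : a ≠ 0 := by
    intro h0; rw [h0] at cup; simp at cup; exact hc0 cup
  have hSt : S ≠ ∞ := by
    intro h0
    rw [h0, ENNReal.mul_top] at clo
    · exact hc (top_le_iff.1 clo)
    · exact mul_ne_zero ha0 (ENNReal.inv_ne_zero.2 hnt)
  refine ⟨hS0, hSt, fun j hj => le_trans ?_ (lo j hj)⟩
  refine ENNReal.div_le_of_le_mul (cup.trans (le_of_eq ?_))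
  rw [sq]
  calc a * n₀ * S = a * ((n₀ : ℝ≥0∞)⁻¹ * n₀) * n₀ * S := by
        rw [ENNReal.inv_mul_cancel hn0 hnt, mul_one]
    _ = _ := by ring

theorem contrBd_doeblin {V W : Type*} [Fintype V] [Fintype W] (b b' : V → W → ℝ≥0∞)
    (M : W → W → ℝ≥0∞) (hb : ∀ v i, b v i = ∑ j, M i j * b' v j)
    (Yp : Set (W × W)) (hprod : Yp = (Prod.fst '' Yp) ×ˢ (Prod.snd '' Yp))
    (n₀ : ℕ) (hn₀ : 1 ≤ n₀)
    (hM : ∀ p ∈ Yp, (n₀ : ℝ≥0∞)⁻¹ ≤ M p.1 p.2 ∧ M p.1 p.2 ≤ n₀)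
    (hM0 : ∀ p ∉ Yp, M p.1 p.2 = 0) {C : ℝ} (h : ContrBd b' C) :
    ContrBd b ((1 - ((n₀ : ℝ) ^ 2)⁻¹) * C) := by
  classical
  have key : ∀ (α : W → ℝ≥0∞) v, ∑ i, α i * b v i = ∑ j, (∑ i, α i * M i j) * b' v j := by
    intro α v
    simp_rw [hb, Finset.mul_sum, Finset.sum_mul]
    rw [Finset.sum_comm]
    simp_rw [mul_assoc]
  intro c α α' hc h1 h2
  by_cases hc0 : c = 0
  · have := contrBd_two b c α α' hc h1 h2
    simpa [hc0] using this
  rw [sum_swap_mass] at h1 h2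
  simp_rw [key] at h1 h2 ⊢
  rw [← sum_swap_mass] at h1 h2
  obtain ⟨hS0, hSt, hd⟩ := doeblin_split _ M Yp hprod n₀ hn₀ hM hM0 c hc hc0 α h1
  obtain ⟨-, -, hd'⟩ := doeblin_split _ M Yp hprod n₀ hn₀ hM hM0 c hc hc0 α' h2
  set S := ∑ j, (Prod.snd '' Yp).indicator (fun j => ∑ v, b' v j) j with hS
  have hn0 : (n₀ : ℝ≥0∞) ≠ 0 := by simp; omega
  have hnt : (n₀ : ℝ≥0∞) ≠ ∞ := by simp
  set δ := c / ((n₀ : ℝ≥0∞) ^ 2 * S) with hδ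
  have hδt : δ ≠ ∞ := ENNReal.div_ne_top hc (mul_ne_zero (pow_ne_zero _ hn0) hS0)
  set D : W → ℝ≥0∞ := (Prod.snd '' Yp).indicator (fun _ => δ) with hD
  have hDS : ∑ j, D j * ∑ v, b' v j = δ * S := by
    rw [hS, Finset.mul_sum]
    refine Finset.sum_congr rfl fun j _ => ?_
    by_cases hj : j ∈ Prod.snd '' Yp
    · rw [hD, Set.indicator_of_mem hj, Set.indicator_of_mem hj]
    · rw [hD, Set.indicator_of_notMem hj, Set.indicator_of_notMem hj]; simp
  have hδS : δ * S = c / (n₀ : ℝ≥0∞) ^ 2 := by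
    rw [hδ, ENNReal.div_eq_inv_mul, ENNReal.div_eq_inv_mul,
      ENNReal.mul_inv (Or.inl (pow_ne_zero _ hn0)) (Or.inr hS0)]
    calc _ = ((n₀ : ℝ≥0∞) ^ 2)⁻¹ * c * (S⁻¹ * S) := by ring
      _ = _ := by rw [ENNReal.inv_mul_cancel hS0 hSt, mul_one]
  have hδSt : δ * S ≠ ∞ := ENNReal.mul_ne_top hδt hSt
  have hDv : ∀ v, ∑ j, D j * b' v j ≠ ∞ := by
    intro v hv
    rw [sum_swap_mass] at hDS
    exact hδSt (hDS ▸ ENNReal.sum_eq_top.2 ⟨v, Finset.mem_univ _, hv⟩)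
  -- general splitting
  have split : ∀ Γ : W → ℝ≥0∞, (∀ j ∈ Prod.snd '' Yp, δ ≤ Γ j) →
      ∑ j, Γ j * ∑ v, b' v j = c →
      (∑ j, (Γ j - D j) * ∑ v, b' v j = c - δ * S) ∧
      ∀ v, (∑ j, Γ j * b' v j).toReal
        = (∑ j, (Γ j - D j) * b' v j).toReal + (∑ j, D j * b' v j).toReal := by
    intro Γ hΓ hsum
    have hle : ∀ j, (Γ j - D j) + D j = Γ j := by
      intro j
      refine tsub_add_cancel_of_le ?_
      by_cases hj : j ∈ Prod.snd '' Yp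
      · rw [hD, Set.indicator_of_mem hj]; exact hΓ j hj
      · rw [hD, Set.indicator_of_notMem hj]; exact zero_le
    have e : ∀ f : W → ℝ≥0∞, ∑ j, Γ j * f j = ∑ j, (Γ j - D j) * f j + ∑ j, D j * f j := by
      intro f
      rw [← Finset.sum_add_distrib]
      refine Finset.sum_congr rfl fun j _ => ?_
      rw [← add_mul, hle]
    have e1 : ∑ j, (Γ j - D j) * ∑ v, b' v j = c - δ * S := by
      rw [← hsum, e, hDS, ENNReal.add_sub_cancel_right hδSt]
    refine ⟨e1, fun v => ?_⟩
    rw [e (b' v), ENNReal.toReal_add _ (hDv v)]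
    intro hv
    rw [sum_swap_mass] at e1
    have : c - δ * S = ∞ := e1 ▸ ENNReal.sum_eq_top.2 ⟨v, Finset.mem_univ _, hv⟩
    exact (ENNReal.sub_ne_top hc) this
  obtain ⟨m1, v1⟩ := split _ hd h1
  obtain ⟨m2, v2⟩ := split _ hd' h2
  have := h (c - δ * S) _ _ (ENNReal.sub_ne_top hc) m1 m2
  have hcs : (c - δ * S).toReal = (1 - ((n₀ : ℝ) ^ 2)⁻¹) * c.toReal := by
    have hle : δ * S ≤ c := by
      rw [hδS]
      refine ENNReal.div_le_of_le_mul ?_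
      have : (1 : ℝ≥0∞) ≤ (n₀ : ℝ≥0∞) ^ 2 := by
        exact_mod_cast Nat.one_le_pow _ _ hn₀
      calc c = c * 1 := by rw [mul_one]
        _ ≤ _ := by gcongr
    rw [ENNReal.toReal_sub_of_le hle hc, hδS, ENNReal.toReal_div]
    simp
    ring
  rw [hcs] at this
  calc _ = _ := Finset.sum_congr rfl fun v _ => by rw [v1, v2, add_sub_add_right_eq_sub]
    _ ≤ _ := this
    _ = _ := by ring

/-- Backward recursion. -/
noncomputable def bk (q : 𝓧 × 𝓨 → 𝓧 × 𝓨 → ℝ≥0∞) (chi : ℕ → 𝓨 → ℝ≥0∞)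
    (g : 𝓧 × 𝓨 → ℝ≥0∞) : ℕ → ℕ → (ℕ → 𝓧) → 𝓨 → ℝ≥0∞
  | 0, k => fun x y => g (x k, y)
  | d + 1, k => fun x y =>
      chi k y * ∑ y' : 𝓨, q (x (k + 1), y') (x k, y) * bk q chi g d (k + 1) x y'

theorem pijD_zero (q : 𝓧 × 𝓨 → 𝓧 × 𝓨 → ℝ≥0∞) (x : Fin (0 + 1) → 𝓧) (i j : 𝓨) :
    pijD q x i j = if i = j then 1 else 0 := by
  unfold pijD
  rw [Fintype.sum_eq_single (fun _ => i)]
  · simp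
  · intro y hy
    rw [if_neg]
    rintro ⟨h, -⟩
    exact hy (by funext a; rw [← h]; congr 1; exact Subsingleton.elim (α := Fin 1) _ _)

theorem pijD_succ (q : 𝓧 × 𝓨 → 𝓧 × 𝓨 → ℝ≥0∞) {R : ℕ} (x : Fin (R + 1 + 1) → 𝓧) (i j : 𝓨) :
    pijD q x i j = ∑ y', q (x 1, y') (x 0, i) * pijD q (fun a : Fin (R + 1) => x a.succ) y' j := by
  unfold pijD
  rw [← (Fin.consEquiv (fun _ : Fin (R + 2) => 𝓨)).sum_comp, Fintype.sum_prod_type]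
  rw [Fintype.sum_eq_single i]
  · simp_rw [Finset.mul_sum]
    rw [Finset.sum_comm]
    refine Finset.sum_congr rfl fun y _ => ?_
    rw [Fintype.sum_eq_single (y 0)]
    · simp only [Fin.consEquiv_apply, Fin.cons_zero, true_and]
      rw [show Fin.last (R + 1) = (Fin.last R).succ from rfl, Fin.cons_succ]
      split_ifs with h
      · rw [Fin.prod_univ_succ]
        rfl
      · simp
    · intro b hb
      rw [if_neg (fun h => hb h.1.symm), mul_zero]
  · intro b hb
    refine Finset.sum_eq_zero fun y _ => ?_
    rw [if_neg]
    rintro ⟨h, -⟩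
    exact hb (by simpa using h)

theorem bk_block (q : 𝓧 × 𝓨 → 𝓧 × 𝓨 → ℝ≥0∞) (chi : ℕ → 𝓨 → ℝ≥0∞)
    (g : 𝓧 × 𝓨 → ℝ≥0∞) (x : ℕ → 𝓧) (R d : ℕ) : ∀ (k : ℕ) (i : 𝓨),
    (∀ a y, k ≤ a → a < k + R → chi a y = 1) →
    bk q chi g (R + d) k x i
      = ∑ j, pijD q (fun a : Fin (R + 1) => x (k + a)) i j * bk q chi g d (k + R) x j := by
  induction R with
  | zero =>
    intro k i _
    simp [pijD_zero]
  | succ R ih =>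
    intro k i hchi
    rw [show R + 1 + d = (R + d) + 1 by ring]
    simp only [bk]
    rw [hchi k i le_rfl (by omega), one_mul]
    simp_rw [pijD_succ, Finset.sum_mul]
    rw [Finset.sum_comm]
    refine Finset.sum_congr rfl fun y' _ => ?_
    rw [ih (k + 1) y' (fun a y h1 h2 => hchi a y (by omega) (by omega)), Finset.mul_sum]
    refine Finset.sum_congr rfl fun j _ => ?_
    simp only [Fin.val_one, Fin.val_zero, Fin.val_succ, add_zero]
    rw [show k + 1 + R = k + (R + 1) by ring, mul_assoc]
    congr 4
    funext a
    congr 1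
    omega

theorem contrBd_blocks {V : Type*} [Fintype V] (q : 𝓧 × 𝓨 → 𝓧 × 𝓨 → ℝ≥0∞)
    (chi : V → ℕ → 𝓨 → ℝ≥0∞) (g : V → 𝓧 × 𝓨 → ℝ≥0∞) (x : ℕ → 𝓧)
    {R : ℕ} (E : Set (Fin (R + 1) → 𝓧)) (Yp : Set (𝓨 × 𝓨)) (hA1 : Assumption1 q E Yp)
    (n₀ : ℕ) (hn₀ : 1 ≤ n₀)
    (hbound : ∀ x ∈ E, ∀ p ∈ Yp,
      ((n₀ : ℝ≥0∞))⁻¹ ≤ pijD q x p.1 p.2 ∧ pijD q x p.1 p.2 ≤ (n₀ : ℝ≥0∞))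
    (t : ℕ) (hchi : ∀ v a y, a < t → chi v a y = 1) (N : ℕ) : ∀ (k d : ℕ), k + N * R ≤ t →
    ContrBd (fun v => bk q (chi v) (g v) (N * R + d) k x)
      (2 * (1 - ((n₀ : ℝ) ^ 2)⁻¹) ^ (∑ u ∈ Finset.range N,
        Set.indicator E (fun _ => 1) (fun i : Fin (R + 1) => x (k + u * R + i)))) := by
  induction N with
  | zero => intro k d _; simpa using contrBd_two _
  | succ N ih =>
    intro k d hk
    have hk' : k + R + N * R ≤ t := by rw [add_mul] at hk; omega
    have h := ih (k + R) d hk'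
    have hb : ∀ v i, bk q (chi v) (g v) ((N + 1) * R + d) k x i = ∑ j,
        pijD q (fun a : Fin (R + 1) => x (k + a)) i j *
          bk q (chi v) (g v) (N * R + d) (k + R) x j := by
      intro v i
      rw [show (N + 1) * R + d = R + (N * R + d) by ring]
      exact bk_block q _ _ x R _ k i (fun a y _ h2 => hchi v a y (by omega))
    have hs : (∑ u ∈ Finset.range (N + 1),
        Set.indicator E (fun _ => 1) (fun i : Fin (R + 1) => x (k + u * R + i)))
        = (∑ u ∈ Finset.range N,
        Set.indicator E (fun _ => 1) (fun i : Fin (R + 1) => x (k + R + u * R + i)))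
        + Set.indicator E (fun _ => 1) (fun i : Fin (R + 1) => x (k + i)) := by
      rw [Finset.sum_range_succ']
      simp only [zero_mul, add_zero]
      congr 1
      refine Finset.sum_congr rfl fun u _ => ?_
      congr 1
      funext i
      congr 1
      ring
    rw [hs]
    by_cases hE : (fun i : Fin (R + 1) => x (k + i)) ∈ E
    · rw [Set.indicator_of_mem hE, pow_succ]
      have := contrBd_doeblin (fun v => bk q (chi v) (g v) ((N + 1) * R + d) k x) _ _ hb Yp
        hA1.2.2.2 n₀ hn₀ (hbound _ hE) ?_ h
      · convert this using 1; ring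
      · intro p hp
        rw [← hA1.2.2.1 _ hE] at hp
        simpa [Yplus] using hp
    · rw [Set.indicator_of_notMem hE, add_zero]
      exact contrBd_push _ _ _ hb h

theorem contrBd_blocks' {V : Type*} [Fintype V] (q : 𝓧 × 𝓨 → 𝓧 × 𝓨 → ℝ≥0∞)
    (chi : V → ℕ → 𝓨 → ℝ≥0∞) (g : V → 𝓧 × 𝓨 → ℝ≥0∞) (x : ℕ → 𝓧)
    {R : ℕ} (E : Set (Fin (R + 1) → 𝓧)) (Yp : Set (𝓨 × 𝓨)) (hA1 : Assumption1 q E Yp)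
    (n₀ : ℕ) (hn₀ : 1 ≤ n₀)
    (hbound : ∀ x ∈ E, ∀ p ∈ Yp,
      ((n₀ : ℝ≥0∞))⁻¹ ≤ pijD q x p.1 p.2 ∧ pijD q x p.1 p.2 ≤ (n₀ : ℝ≥0∞))
    (t : ℕ) (hchi : ∀ v a y, a < t → chi v a y = 1) (N s a n : ℕ) (hsa : s ≤ a)
    (hN : a + N * R ≤ t) (htn : t ≤ n) :
    ContrBd (fun v => bk q (chi v) (g v) (n - s) s x)
      (2 * (1 - ((n₀ : ℝ) ^ 2)⁻¹) ^ (∑ u ∈ Finset.range N,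
        Set.indicator E (fun _ => 1) (fun i : Fin (R + 1) => x (a + u * R + i)))) := by
  obtain ⟨e, rfl⟩ := Nat.exists_eq_add_of_le hsa
  have h := contrBd_blocks q chi g x E Yp hA1 n₀ hn₀ hbound t hchi N (s + e) (n - (s + e) - N * R) hN
  refine contrBd_push _ _ (fun i j => pijD q (fun a : Fin (e + 1) => x (s + a)) i j)
    (fun v i => ?_) h
  rw [show n - s = e + (N * R + (n - (s + e) - N * R)) by omega]
  exact bk_block q _ _ x e _ s i (fun a y _ h2 => hchi v a y (by omega))

theorem contrBd_counts {V : Type*} [Fintype V] (q : 𝓧 × 𝓨 → 𝓧 × 𝓨 → ℝ≥0∞)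
    (chi : V → ℕ → 𝓨 → ℝ≥0∞) (g : V → 𝓧 × 𝓨 → ℝ≥0∞)
    {Ω : Type*} (Z : ℕ → Ω → 𝓧 × 𝓨) (ω : Ω)
    {R : ℕ} (E : Set (Fin (R + 1) → 𝓧)) (Yp : Set (𝓨 × 𝓨)) (hA1 : Assumption1 q E Yp)
    (n₀ : ℕ) (hn₀ : 1 ≤ n₀)
    (hbound : ∀ x ∈ E, ∀ p ∈ Yp,
      ((n₀ : ℝ≥0∞))⁻¹ ≤ pijD q x p.1 p.2 ∧ pijD q x p.1 p.2 ≤ (n₀ : ℝ≥0∞))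
    (s t n kk : ℕ) (hst : s ≤ t) (htn : t ≤ n) (hchi : ∀ v a y, a < t → chi v a y = 1) :
    ContrBd (fun v => bk q (chi v) (g v) (n - s) s (fun k => (Z k ω).1))
      (2 * (1 - ((n₀ : ℝ) ^ 2)⁻¹) ^ kapCount Z E s t kk ω) ∧
    ContrBd (fun v => bk q (chi v) (g v) (n - s) s (fun k => (Z k ω).1))
      (2 * (1 - ((n₀ : ℝ) ^ 2)⁻¹) ^ kapBar Z E s t ω) := by
  constructor
  · by_cases h0 : (t - kk - s) / R = 0
    · unfold kapCount
      rw [h0]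
      simpa using contrBd_two _
    · have hle := Nat.div_mul_le_self (t - kk - s) R
      have hpos : 0 < t - kk - s := by
        rcases Nat.eq_zero_or_pos (t - kk - s) with h | h
        · rw [h] at h0; simp at h0
        · exact h
      have := contrBd_blocks' q chi g (fun k => (Z k ω).1) E Yp hA1 n₀ hn₀ hbound t hchi
        ((t - kk - s) / R) s (s + kk) n (by omega) (by omega) htn
      convert this using 3
      unfold kapCount
      refine Finset.sum_congr rfl fun u _ => ?_
      congr 1
      funext i
      rw [show u * R + s + kk + (i : ℕ) = s + kk + u * R + i by ring]
  · have hle := Nat.div_mul_le_self (t - s) R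
    have := contrBd_blocks' q chi g (fun k => (Z k ω).1) E Yp hA1 n₀ hn₀ hbound t hchi
        ((t - s) / R) s (t - (t - s) / R * R) n (by omega) (by omega) htn
    convert this using 3
    unfold kapBar
    rw [← Finset.sum_range_reflect]
    refine Finset.sum_congr rfl fun u hu => ?_
    congr 1
    funext i
    rw [Finset.mem_range] at hu
    set T := (t - s) / R
    have e : (T - 1 - u + 1) * R + u * R = T * R := by
      rw [← add_mul]; congr 1; omega
    rw [show t - (T - 1 - u + 1) * R + (i : ℕ) = t - T * R + u * R + i by omega]

/-! ### Markov step -/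

theorem lintegral_prod_count (μ : Measure 𝓧) [SigmaFinite μ] (f : 𝓧 × 𝓨 → ℝ≥0∞)
    (hf : Measurable f) :
    ∫⁻ z, f z ∂(μ.prod Measure.count) = ∫⁻ x, ∑ y, f (x, y) ∂μ := by
  rw [lintegral_prod _ hf.aemeasurable]
  refine lintegral_congr fun x => ?_
  rw [lintegral_count, tsum_fintype]

theorem markov_step {P : Measure Ω} {Z : ℕ → Ω → 𝓧 × 𝓨} {κ : Kernel (𝓧 × 𝓨) (𝓧 × 𝓨)}
    {μ : Measure 𝓧} {q : 𝓧 × 𝓨 → 𝓧 × 𝓨 → ℝ≥0∞} {p0 : 𝓧 × 𝓨 → ℝ≥0∞}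
    (hPMM : IsPMM P Z κ μ q p0) (k : ℕ) (H : (ℕ → 𝓧 × 𝓨) → ℝ≥0∞) (hH : Measurable H)
    (hdep : ∀ ζ ζ' : ℕ → 𝓧 × 𝓨, (∀ j ≤ k + 1, ζ j = ζ' j) → H ζ = H ζ') :
    ∫⁻ ω, H (fun j => Z j ω) ∂P = ∫⁻ ω, ∫⁻ x', ∑ y', q (x', y') (Z k ω) *
      H (Function.update (fun j => Z j ω) (k + 1) (x', y')) ∂μ ∂P := by
  obtain ⟨hP, ⟨hZ, hMk⟩, hμ, hq, -, hκ, -⟩ := hPMM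
  set lam : Measure (𝓧 × 𝓨) := μ.prod Measure.count with hlam
  set W : Ω → ℕ → 𝓧 × 𝓨 := fun ω j => Z (min j k) ω with hW
  have hWF : Measurable[⨆ i ∈ Set.Iic k, MeasurableSpace.comap (Z i) inferInstance] W := by
    rw [@measurable_pi_iff]
    intro j
    have h1 : MeasurableSpace.comap (Z (min j k)) inferInstance ≤
        ⨆ i ∈ Set.Iic k, MeasurableSpace.comap (Z i) inferInstance :=
      le_iSup₂_of_le (min j k) (min_le_right j k) le_rfl
    exact measurable_iff_comap_le.2 h1
  have hWm : Measurable W := measurable_pi_iff.2 fun j => hZ _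
  have hqm : Measurable (fun p : Ω × (𝓧 × 𝓨) => q p.2 (Z k p.1)) :=
    hq.comp (measurable_snd.prodMk ((hZ k).comp measurable_fst))
  have hWp : Measurable (fun p : Ω × (𝓧 × 𝓨) => (W p.1, p.2)) :=
    (hWm.comp measurable_fst).prodMk measurable_snd
  have hWZ : Measurable (fun ω => (W ω, Z (k + 1) ω)) := hWm.prodMk (hZ _)
  have key : P.map (fun ω => (W ω, Z (k + 1) ω)) =
      ((P.prod lam).withDensity (fun p => q p.2 (Z k p.1))).map (fun p => (W p.1, p.2)) := by
    have : IsFiniteMeasure (P.map (fun ω => (W ω, Z (k + 1) ω))) := inferInstance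
    refine Measure.ext_prod fun {A B} hA hB => ?_
    have hAB := hA.prod hB
    rw [Measure.map_apply hWZ hAB, Measure.map_apply hWp hAB,
      withDensity_apply _ (hWp hAB)]
    have e1 : (fun p : Ω × (𝓧 × 𝓨) => (W p.1, p.2)) ⁻¹' (A ×ˢ B) = (W ⁻¹' A) ×ˢ B := rfl
    have e2 : (fun ω => (W ω, Z (k + 1) ω)) ⁻¹' (A ×ˢ B) = (Z (k + 1) ⁻¹' B) ∩ (W ⁻¹' A) := by
      ext ω; simp [and_comm]
    rw [e1, e2, ← Measure.prod_restrict, lintegral_prod _ hqm.aemeasurable]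
    have h := hMk k (B.indicator fun _ => 1) (measurable_const.indicator hB) (W ⁻¹' A) (hWF hA)
    have h1 : ∫⁻ ω in W ⁻¹' A, B.indicator (fun _ => (1 : ℝ≥0∞)) (Z (k + 1) ω) ∂P
        = P ((Z (k + 1) ⁻¹' B) ∩ (W ⁻¹' A)) := by
      rw [← Measure.restrict_apply (hZ _ hB), ← lintegral_indicator_one (hZ _ hB)]
      rfl
    rw [← h1, h]
    refine lintegral_congr fun ω => ?_
    rw [lintegral_indicator_const hB, one_mul, hκ, withDensity_apply _ hB]
  set Ψ : (ℕ → 𝓧 × 𝓨) × (𝓧 × 𝓨) → ℝ≥0∞ := fun p => H (Function.update p.1 (k + 1) p.2) with hΨ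
  have hupd : Measurable (fun p : (ℕ → 𝓧 × 𝓨) × (𝓧 × 𝓨) => Function.update p.1 (k + 1) p.2) := by
    refine measurable_pi_iff.2 fun j => ?_
    by_cases hj : j = k + 1
    · subst hj; simpa using measurable_snd
    · simp only [Function.update_of_ne hj]
      exact (measurable_pi_apply j).comp measurable_fst
  have hΨm : Measurable Ψ := hH.comp hupd
  have l1 : ∫⁻ ω, H (fun j => Z j ω) ∂P = ∫⁻ p, Ψ p ∂(P.map (fun ω => (W ω, Z (k + 1) ω))) := by
    rw [lintegral_map hΨm hWZ]
    refine lintegral_congr fun ω => hdep _ _ fun j hj => ?_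
    by_cases hj' : j = k + 1
    · subst hj'; simp
    · rw [Function.update_of_ne hj', hW]
      simp only
      rw [min_eq_left (by omega)]
  have hm3 : Measurable fun p : Ω × (𝓧 × 𝓨) => Ψ (W p.1, p.2) := hΨm.comp hWp
  rw [l1, key, lintegral_map hΨm hWp, lintegral_withDensity_eq_lintegral_mul _ hqm hm3,
    lintegral_prod _ (hqm.mul hm3).aemeasurable]
  refine lintegral_congr fun ω => ?_
  refine (lintegral_prod_count μ (fun z => ((fun p : Ω × (𝓧 × 𝓨) => q p.2 (Z k p.1)) *
    fun p : Ω × (𝓧 × 𝓨) => Ψ (W p.1, p.2)) (ω, z)) ((hqm.mul hm3).comp measurable_prodMk_left)).trans ?_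
  refine lintegral_congr fun x' => Finset.sum_congr rfl fun y' _ => ?_
  simp only [Pi.mul_apply, hΨ]
  congr 1
  refine hdep _ _ fun j hj => ?_
  by_cases hj' : j = k + 1
  · subst hj'; simp
  · rw [Function.update_of_ne hj', Function.update_of_ne hj', hW]
    simp only
    rw [min_eq_left (by omega)]

/-! ### Backward representation -/

noncomputable def gk (q : 𝓧 × 𝓨 → 𝓧 × 𝓨 → ℝ≥0∞) (chi : ℕ → 𝓨 → ℝ≥0∞) (μ : Measure 𝓧) :
    ℕ → ℕ → 𝓧 × 𝓨 → ℝ≥0∞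
  | 0, k => fun z => chi k z.2
  | e + 1, k => fun z => chi k z.2 *
      ∫⁻ x', ∑ y' : 𝓨, q (x', y') z * gk q chi μ e (k + 1) (x', y') ∂μ

theorem measurable_fin {f : 𝓨 → ℝ≥0∞} : Measurable f := measurable_of_finite f

theorem measurable_gk {q : 𝓧 × 𝓨 → 𝓧 × 𝓨 → ℝ≥0∞} (hq : Measurable (Function.uncurry q))
    (chi : ℕ → 𝓨 → ℝ≥0∞) (μ : Measure 𝓧) [SigmaFinite μ] (e : ℕ) :
    ∀ k, Measurable (gk q chi μ e k) := by
  induction e with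
  | zero => intro k; exact (measurable_fin (f := chi k)).comp measurable_snd
  | succ e ih =>
    intro k
    have h1 : Measurable fun z : 𝓧 × 𝓨 => chi k z.2 := (measurable_fin (f := chi k)).comp measurable_snd
    refine h1.mul ?_
    refine Measurable.lintegral_prod_right'
      (f := fun p : (𝓧 × 𝓨) × 𝓧 => ∑ y', q (p.2, y') p.1 * gk q chi μ e (k + 1) (p.2, y')) ?_
    refine Finset.measurable_sum _ fun y' _ => ?_
    refine Measurable.mul ?_ ?_
    · exact hq.comp ((measurable_snd.prodMk measurable_const).prodMk measurable_fst)
    · exact (ih (k + 1)).comp (measurable_snd.prodMk measurable_const)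

theorem measurable_qpath {q : 𝓧 × 𝓨 → 𝓧 × 𝓨 → ℝ≥0∞} (hq : Measurable (Function.uncurry q))
    (k : ℕ) (y y' : 𝓨) : Measurable fun x : ℕ → 𝓧 => q (x (k + 1), y') (x k, y) := by
  have h : Measurable fun x : ℕ → 𝓧 => ((x (k + 1), y'), (x k, y)) := by fun_prop
  exact hq.comp h

theorem measurable_bk {q : 𝓧 × 𝓨 → 𝓧 × 𝓨 → ℝ≥0∞} (hq : Measurable (Function.uncurry q))
    (chi : ℕ → 𝓨 → ℝ≥0∞) {g : 𝓧 × 𝓨 → ℝ≥0∞} (hg : Measurable g) (d : ℕ) :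
    ∀ k y, Measurable (fun x => bk q chi g d k x y) := by
  induction d with
  | zero =>
    intro k y
    exact hg.comp ((measurable_pi_apply k).prodMk measurable_const)
  | succ d ih =>
    intro k y
    refine measurable_const.mul (Finset.measurable_sum _ fun y' _ => ?_)
    refine Measurable.mul ?_ (ih _ _)
    exact measurable_qpath hq k y y'

theorem bk_congr (q : 𝓧 × 𝓨 → 𝓧 × 𝓨 → ℝ≥0∞) (chi : ℕ → 𝓨 → ℝ≥0∞) (g : 𝓧 × 𝓨 → ℝ≥0∞) (d : ℕ)
    (x x' : ℕ → 𝓧) : ∀ k y, (∀ j, k ≤ j → j ≤ k + d → x j = x' j) →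
      bk q chi g d k x y = bk q chi g d k x' y := by
  induction d with
  | zero => intro k y h; simp only [bk]; rw [h k le_rfl le_rfl]
  | succ d ih =>
    intro k y h
    simp only [bk]
    rw [h k le_rfl (by omega), h (k + 1) (by omega) (by omega)]
    congr 1
    refine Finset.sum_congr rfl fun y' _ => ?_
    rw [ih (k + 1) y' (fun j h1 h2 => h j (by omega) (by omega))]

theorem lm_mul_left (μ : Measure 𝓧) [SigmaFinite μ] (s : Finset ℕ) (c f : (ℕ → 𝓧) → ℝ≥0∞)
    (hc : ∀ x y, c (Function.updateFinset x s y) = c x) (hf : Measurable f) (x : ℕ → 𝓧) :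
    lmarginal (fun _ => μ) s (fun x => c x * f x) x = c x * lmarginal (fun _ => μ) s f x := by
  simp only [lmarginal, hc]
  exact lintegral_const_mul _ (hf.comp measurable_updateFinset)

theorem lm_sum (μ : Measure 𝓧) [SigmaFinite μ] (s : Finset ℕ) {ι : Type*} (T : Finset ι)
    (f : ι → (ℕ → 𝓧) → ℝ≥0∞)
    (hf : ∀ i, Measurable (f i)) (x : ℕ → 𝓧) :
    lmarginal (fun _ => μ) s (fun x => ∑ i ∈ T, f i x) x
      = ∑ i ∈ T, lmarginal (fun _ => μ) s (f i) x := by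
  simp only [lmarginal]
  exact lintegral_finsetSum _ fun i _ => (hf i).comp measurable_updateFinset

/-- Product of the indicators before time `k`. -/
noncomputable def pre (chi : ℕ → 𝓨 → ℝ≥0∞) (k : ℕ) (ζ : ℕ → 𝓧 × 𝓨) : ℝ≥0∞ :=
  ∏ j ∈ Finset.range k, chi j (ζ j).2

theorem measurable_pre (chi : ℕ → 𝓨 → ℝ≥0∞) (k : ℕ) :
    Measurable (pre chi k : (ℕ → 𝓧 × 𝓨) → ℝ≥0∞) := by
  refine Finset.measurable_prod _ fun j _ => ?_
  exact (measurable_fin (f := chi j)).comp (measurable_snd.comp (measurable_pi_apply j))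

theorem pre_congr (chi : ℕ → 𝓨 → ℝ≥0∞) (k : ℕ) (ζ ζ' : ℕ → 𝓧 × 𝓨) (h : ∀ j < k, ζ j = ζ' j) :
    pre chi k ζ = pre chi k ζ' := by
  refine Finset.prod_congr rfl fun j hj => ?_
  rw [h j (Finset.mem_range.1 hj)]

theorem pre_succ (chi : ℕ → 𝓨 → ℝ≥0∞) (k : ℕ) (ζ : ℕ → 𝓧 × 𝓨) :
    pre chi (k + 1) ζ = pre chi k ζ * chi k (ζ k).2 := Finset.prod_range_succ _ _

theorem measurable_fstpath : Measurable (fun (ζ : ℕ → 𝓧 × 𝓨) (j : ℕ) => (ζ j).1) :=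
  measurable_pi_iff.2 fun j => measurable_fst.comp (measurable_pi_apply j)

theorem fst_update (ζ : ℕ → 𝓧 × 𝓨) (k : ℕ) (x : 𝓧) (y : 𝓨) :
    (fun j => (Function.update ζ k (x, y) j).1) = Function.update (fun j => (ζ j).1) k x := by
  funext j
  by_cases h : j = k
  · subst h; simp
  · simp [Function.update_of_ne h]

theorem tail_rep {P : Measure Ω} {Z : ℕ → Ω → 𝓧 × 𝓨} {κ : Kernel (𝓧 × 𝓨) (𝓧 × 𝓨)}
    {μ : Measure 𝓧} {q : 𝓧 × 𝓨 → 𝓧 × 𝓨 → ℝ≥0∞} {p0 : 𝓧 × 𝓨 → ℝ≥0∞}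
    (hPMM : IsPMM P Z κ μ q p0) (chi : ℕ → 𝓨 → ℝ≥0∞) (n : ℕ)
    (G : (ℕ → 𝓧) → ℝ≥0∞) (hG : Measurable G)
    (hGd : ∀ x x' : ℕ → 𝓧, (∀ j ≤ n, x j = x' j) → G x = G x') (e : ℕ) : ∀ k, n ≤ k →
    ∫⁻ ω, pre chi (k + e + 1) (fun j => Z j ω) * G (fun j => (Z j ω).1) ∂P
      = ∫⁻ ω, pre chi k (fun j => Z j ω) * gk q chi μ e k (Z k ω) * G (fun j => (Z j ω).1) ∂P := by
  have hμ : SigmaFinite μ := hPMM.2.2.1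
  have hq := hPMM.2.2.2.1
  induction e with
  | zero =>
    intro k _
    simp only [add_zero, pre_succ, gk]
  | succ e ih =>
    intro k hk
    have h := ih (k + 1) (by omega)
    rw [show k + (e + 1) + 1 = k + 1 + e + 1 by ring, h]
    have hg := measurable_gk hq chi μ e (k + 1)
    rw [markov_step hPMM k (fun ζ => pre chi (k + 1) ζ * gk q chi μ e (k + 1) (ζ (k + 1)) *
      G (fun j => (ζ j).1))]
    · refine lintegral_congr fun ω => ?_
      have e1 : ∀ x' y', pre chi (k + 1) (Function.update (fun j => Z j ω) (k + 1) (x', y'))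
          = pre chi (k + 1) (fun j => Z j ω) := fun x' y' =>
        pre_congr _ _ _ _ fun j hj => Function.update_of_ne (by omega) _ _
      have e2 : ∀ x' y', G (fun j => (Function.update (fun j => Z j ω) (k + 1) (x', y') j).1)
          = G (fun j => (Z j ω).1) := fun x' y' =>
        hGd _ _ fun j hj => by rw [Function.update_of_ne (by omega)]
      simp only [e1, e2, Function.update_self]
      have e3 : ∀ x', ∑ y', q (x', y') (Z k ω) * (pre chi (k + 1) (fun j => Z j ω) *
          gk q chi μ e (k + 1) (x', y') * G (fun j => (Z j ω).1))
          = (pre chi (k + 1) (fun j => Z j ω) * G (fun j => (Z j ω).1)) *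
            ∑ y', q (x', y') (Z k ω) * gk q chi μ e (k + 1) (x', y') := by
        intro x'
        rw [Finset.mul_sum]
        exact Finset.sum_congr rfl fun y' _ => by ring
      simp only [e3]
      rw [lintegral_const_mul]
      · simp only [pre_succ, gk]
        ring
      · refine Finset.measurable_sum _ fun y' _ => Measurable.mul ?_ ?_
        · exact hq.comp ((measurable_id.prodMk measurable_const).prodMk measurable_const)
        · exact hg.comp (measurable_id.prodMk measurable_const)
    · exact ((measurable_pre chi (k + 1)).mul (hg.comp (measurable_pi_apply _))).mul
        (hG.comp measurable_fstpath)
    · intro ζ ζ' hh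
      rw [pre_congr chi (k + 1) ζ ζ' (fun j hj => hh j (by omega)), hh (k + 1) le_rfl,
        hGd (fun j => (ζ j).1) (fun j => (ζ' j).1) (fun j hj => by rw [hh j (by omega)])]

theorem lm_expand {μ : Measure 𝓧} [SigmaFinite μ] {q : 𝓧 × 𝓨 → 𝓧 × 𝓨 → ℝ≥0∞}
    (hq : Measurable (Function.uncurry q)) (chi : ℕ → 𝓨 → ℝ≥0∞)
    {g : 𝓧 × 𝓨 → ℝ≥0∞} (hg : Measurable g) (n k d : ℕ)
    (G : (ℕ → 𝓧) → ℝ≥0∞) (hG : Measurable G) (y : 𝓨) (u : ℕ → 𝓧) :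
    lmarginal (fun _ => μ) (Finset.Ioc (k + 1) n) (fun x => G x * bk q chi g (d + 1) k x y) u
      = chi k y * ∑ y', q (u (k + 1), y') (u k, y) *
        lmarginal (fun _ => μ) (Finset.Ioc (k + 1) n) (fun x => G x * bk q chi g d (k + 1) x y') u := by
  have hm : ∀ y', Measurable fun x => G x * bk q chi g d (k + 1) x y' := fun y' =>
    hG.mul (measurable_bk hq chi hg d (k + 1) y')
  have hqm : ∀ y', Measurable fun x : ℕ → 𝓧 => q (x (k + 1), y') (x k, y) := fun y' => measurable_qpath hq k y y'
  have e : (fun x => G x * bk q chi g (d + 1) k x y) = fun x => chi k y *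
      ∑ y', q (x (k + 1), y') (x k, y) * (G x * bk q chi g d (k + 1) x y') := by
    funext x
    simp only [bk, Finset.mul_sum]
    exact Finset.sum_congr rfl fun y' _ => by ring
  have hmm : ∀ y', Measurable fun x => q (x (k + 1), y') (x k, y) *
      (G x * bk q chi g d (k + 1) x y') := fun y' => (hqm y').mul (hm y')
  have hsum : Measurable fun x => ∑ y', q (x (k + 1), y') (x k, y) *
      (G x * bk q chi g d (k + 1) x y') := Finset.measurable_sum _ fun y' _ => hmm y'
  rw [e, lm_mul_left μ _ (fun _ => chi k y) _ (fun _ _ => rfl) hsum,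
    lm_sum μ _ Finset.univ (fun y' x => q (x (k + 1), y') (x k, y) *
      (G x * bk q chi g d (k + 1) x y')) hmm]
  congr 1
  refine Finset.sum_congr rfl fun y' _ => ?_
  rw [lm_mul_left μ _ (fun x => q (x (k + 1), y') (x k, y)) _ _ (hm y')]
  intro x z
  simp [Function.updateFinset]

theorem mid_rep {P : Measure Ω} {Z : ℕ → Ω → 𝓧 × 𝓨} {κ : Kernel (𝓧 × 𝓨) (𝓧 × 𝓨)}
    {μ : Measure 𝓧} {q : 𝓧 × 𝓨 → 𝓧 × 𝓨 → ℝ≥0∞} {p0 : 𝓧 × 𝓨 → ℝ≥0∞}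
    (hPMM : IsPMM P Z κ μ q p0) (chi : ℕ → 𝓨 → ℝ≥0∞) (n e : ℕ)
    (G : (ℕ → 𝓧) → ℝ≥0∞) (hG : Measurable G)
    (hGd : ∀ x x' : ℕ → 𝓧, (∀ j ≤ n, x j = x' j) → G x = G x') (d : ℕ) : ∀ k, k + d = n →
    ∫⁻ ω, pre chi (n + e + 1) (fun j => Z j ω) * G (fun j => (Z j ω).1) ∂P
      = ∫⁻ ω, pre chi k (fun j => Z j ω) *
        lmarginal (fun _ => μ) (Finset.Ioc k n)
          (fun x => G x * bk q chi (gk q chi μ e n) d k x (Z k ω).2) (fun j => (Z j ω).1) ∂P := by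
  have hμ : SigmaFinite μ := hPMM.2.2.1
  have hq := hPMM.2.2.2.1
  have hg := measurable_gk hq chi μ e n
  induction d with
  | zero =>
    intro k hk
    obtain rfl : k = n := by omega
    rw [tail_rep hPMM chi k G hG hGd e k le_rfl]
    simp only [Finset.Ioc_self, lmarginal_empty, bk]
    refine lintegral_congr fun ω => ?_
    ring
  | succ d ih =>
    intro k hk
    rw [ih (k + 1) (by omega)]
    set Lm : 𝓨 → (ℕ → 𝓧) → ℝ≥0∞ := fun y => lmarginal (fun _ => μ) (Finset.Ioc (k + 1) n)
          (fun x => G x * bk q chi (gk q chi μ e n) d (k + 1) x y) with hLm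
    have hm : ∀ y', Measurable fun x => G x * bk q chi (gk q chi μ e n) d (k + 1) x y' := fun y' =>
      hG.mul (measurable_bk hq chi hg d (k + 1) y')
    have hLmm : ∀ y, Measurable (Lm y) := fun y => (hm y).lmarginal _
    have hLmd : ∀ y x x', (∀ j ≤ k + 1, x j = x' j) → Lm y x = Lm y x' := by
      intro y x x' hh
      simp only [hLm, lmarginal]
      refine lintegral_congr fun z => ?_
      have ha : ∀ j ≤ n, Function.updateFinset x (Finset.Ioc (k + 1) n) z j
          = Function.updateFinset x' (Finset.Ioc (k + 1) n) z j := by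
        intro j hj
        unfold Function.updateFinset
        split_ifs with h
        · rfl
        · exact hh j (by simp only [Finset.mem_Ioc] at h; omega)
      rw [hGd _ _ ha, bk_congr q chi _ d _ _ (k + 1) y (fun j _ h2 => ha j (by omega))]
    rw [markov_step hPMM k (fun ζ => pre chi (k + 1) ζ * Lm (ζ (k + 1)).2 (fun j => (ζ j).1))]
    · refine lintegral_congr fun ω => ?_
      have e1 : ∀ x' y', pre chi (k + 1) (Function.update (fun j => Z j ω) (k + 1) (x', y'))
          = pre chi (k + 1) (fun j => Z j ω) := fun x' y' =>
        pre_congr _ _ _ _ fun j hj => Function.update_of_ne (by omega) _ _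
      simp only [e1, fst_update, Function.update_self]
      rw [show Finset.Ioc k n = insert (k + 1) (Finset.Ioc (k + 1) n) by
        ext j; simp only [Finset.mem_insert, Finset.mem_Ioc]; omega]
      have hm' : Measurable fun x => G x * bk q chi (gk q chi μ e n) (d + 1) k x (Z k ω).2 :=
        hG.mul (measurable_bk hq chi hg (d + 1) k _)
      rw [lmarginal_insert _ hm' (by simp)]
      simp only [lm_expand hq chi hg n k d G hG, Function.update_self]
      have hk1 : ∀ x' : 𝓧, Function.update (fun j => (Z j ω).1) (k + 1) x' k = (Z k ω).1 := by
        intro x'; rw [Function.update_of_ne (by omega)]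
      simp only [hk1]
      rw [← lintegral_const_mul]
      · refine lintegral_congr fun x' => ?_
        rw [pre_succ, Finset.mul_sum, Finset.mul_sum]
        refine Finset.sum_congr rfl fun y' _ => ?_
        simp only [hLm, Prod.mk.eta]
        ring
      · refine measurable_const.mul (Finset.measurable_sum _ fun y' _ => ?_)
        refine Measurable.mul ?_ ((hLmm y').comp (measurable_update _))
        exact hq.comp ((measurable_id.prodMk measurable_const).prodMk measurable_const)
    · refine (measurable_pre chi (k + 1)).mul ?_
      have h1 : Measurable fun p : (ℕ → 𝓧) × 𝓨 => Lm p.2 p.1 :=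
        measurable_from_prod_countable_left fun y => hLmm y
      exact h1.comp (measurable_fstpath.prodMk (measurable_snd.comp (measurable_pi_apply (k + 1))))
    · intro ζ ζ' hh
      rw [pre_congr chi (k + 1) ζ ζ' (fun j hj => hh j (by omega)), hh (k + 1) le_rfl,
        hLmd _ (fun j => (ζ j).1) (fun j => (ζ' j).1) (fun j hj => by rw [hh j (by omega)])]


/-! ### Bayes formula and conditional expectations -/

theorem bayes {T V : Type*} [MeasurableSpace T] [Fintype V] (P : Measure Ω) [IsProbabilityMeasure P]
    (X : Ω → T) (hX : Measurable X) (A : V → Set Ω) (hA : ∀ v, MeasurableSet (A v))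
    (hsum : ∀ ω, ∑ v, (A v).indicator (fun _ => (1 : ℝ≥0∞)) ω = 1)
    (Λ : Measure T) (f : V → T → ℝ≥0∞) (hf : ∀ v, Measurable (f v))
    (hrep : ∀ v, (P.restrict (A v)).map X = Λ.withDensity (f v)) :
    ∀ᵐ ω ∂P, (∑ v, f v (X ω) ≠ 0 ∧ ∑ v, f v (X ω) ≠ ∞) ∧
      ∀ v, (P[(A v).indicator (fun _ => (1 : ℝ)) | MeasurableSpace.comap X inferInstance]) ω
        = (f v (X ω) / ∑ v, f v (X ω)).toReal := by
  set F : T → ℝ≥0∞ := fun x => ∑ v, f v x with hF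
  have hFm : Measurable F := Finset.measurable_sum _ fun v _ => hf v
  have hD : ∀ v D, MeasurableSet D → P (A v ∩ X ⁻¹' D) = ∫⁻ x in D, f v x ∂Λ := by
    intro v D hD
    have h := congrArg (fun ν => ν D) (hrep v)
    rw [Measure.map_apply hX hD, withDensity_apply _ hD, Measure.restrict_apply (hX hD),
      Set.inter_comm] at h
    exact h
  have hmap : P.map X = Λ.withDensity F := by
    ext D hDm
    rw [withDensity_apply _ hDm, Measure.map_apply hX hDm, hF,
      lintegral_finsetSum _ fun v _ => hf v]
    rw [Finset.sum_congr rfl fun v _ => (hD v D hDm).symm]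
    have h1 : ∀ v, P (A v ∩ X ⁻¹' D) = ∫⁻ ω in X ⁻¹' D, (A v).indicator (fun _ => (1 : ℝ≥0∞)) ω ∂P := by
      intro v
      rw [← Measure.restrict_apply (hA v), ← lintegral_indicator_one (hA v)]
      rfl
    simp only [h1]
    rw [← lintegral_finsetSum _ fun v _ => measurable_const.indicator (hA v)]
    simp only [hsum]
    simp
  have hFint : ∫⁻ x, F x ∂Λ = 1 := by
    have h : (Λ.withDensity F) Set.univ = 1 := by
      rw [← hmap, Measure.map_apply hX MeasurableSet.univ]; simp
    rwa [withDensity_apply _ MeasurableSet.univ, Measure.restrict_univ] at h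
  have hFtop : ∀ᵐ x ∂Λ, F x < ∞ := ae_lt_top hFm (by rw [hFint]; exact ENNReal.one_ne_top)
  have hne : ∀ᵐ x ∂(P.map X), F x ≠ 0 ∧ F x ≠ ∞ := by
    rw [hmap]
    refine Filter.Eventually.and ?_ ?_
    · rw [ae_withDensity_iff hFm]
      exact Filter.Eventually.of_forall fun x h => h
    · exact (withDensity_absolutelyContinuous Λ F).ae_le (hFtop.mono fun x h => h.ne)
  have hle1 : ∀ v x, f v x / F x ≤ 1 := fun v x =>
    ENNReal.div_le_of_le_mul (by
      rw [one_mul]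
      exact Finset.single_le_sum (f := fun v => f v x) (fun _ _ => zero_le) (Finset.mem_univ v))
  have hdm : ∀ v, Measurable fun x => f v x / F x := fun v => (hf v).div hFm
  have hmle : MeasurableSpace.comap X inferInstance ≤ (inferInstance : MeasurableSpace Ω) :=
    measurable_iff_comap_le.1 hX
  have hlint : ∀ v D, MeasurableSet D →
      ∫⁻ ω in X ⁻¹' D, f v (X ω) / F (X ω) ∂P = P (A v ∩ X ⁻¹' D) := by
    intro v D hDm
    rw [← setLIntegral_map hDm (hdm v) hX, hmap,
      setLIntegral_withDensity_eq_setLIntegral_mul _ hFm (hdm v) hDm, hD v D hDm]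
    refine lintegral_congr_ae (ae_restrict_of_ae (hFtop.mono fun x hx => ?_))
    simp only [Pi.mul_apply]
    by_cases h0 : F x = 0
    · have : f v x = 0 := by
        have := (Finset.sum_eq_zero_iff.1 h0) v (Finset.mem_univ v)
        exact this
      rw [this, h0]; simp
    · exact ENNReal.mul_div_cancel h0 hx.ne
  have hae := ae_of_ae_map hX.aemeasurable hne
  have hcond : ∀ v, (fun ω => (f v (X ω) / F (X ω)).toReal) =ᵐ[P]
      P[(A v).indicator (fun _ => (1 : ℝ)) | MeasurableSpace.comap X inferInstance] := by
    intro v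
    have hinteg : Integrable (fun ω => (f v (X ω) / F (X ω)).toReal) P := by
      refine Integrable.of_bound ((hdm v).comp hX).ennreal_toReal.aestronglyMeasurable 1
        (Filter.Eventually.of_forall fun ω => ?_)
      rw [Real.norm_of_nonneg ENNReal.toReal_nonneg]
      exact ENNReal.toReal_le_of_le_ofReal zero_le_one (by simpa using hle1 v (X ω))
    refine ae_eq_condExp_of_forall_setIntegral_eq hmle
      ((integrable_const 1).indicator (hA v)) (fun _ _ _ => hinteg.integrableOn) ?_ ?_
    · rintro _ ⟨D, hDm, rfl⟩ -
      have hdX : Measurable fun ω => f v (X ω) / F (X ω) := (hdm v).comp hX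
      rw [integral_toReal hdX.aemeasurable
        (Filter.Eventually.of_forall fun ω => (hle1 v (X ω)).trans_lt ENNReal.one_lt_top)]
      rw [hlint v D hDm, integral_indicator (hA v), Measure.restrict_restrict (hA v)]
      simp [Measure.real]
    · refine StronglyMeasurable.aestronglyMeasurable ?_
      refine Measurable.stronglyMeasurable ?_
      exact (hdm v).ennreal_toReal.comp (comap_measurable X)
  filter_upwards [hae, ae_all_iff.2 hcond] with ω h1 h2
  exact ⟨h1, fun v => (h2 v).symm⟩

/-! ### Clamped observation paths -/

/-- Clamp a path to the window `[l, n]`. -/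
def cl {𝓧 : Type*} (l n : ℕ) (x : ℕ → 𝓧) (j : ℕ) : 𝓧 := x (max l (min j n))

theorem measurable_cl (l n : ℕ) : Measurable (cl l n : (ℕ → 𝓧) → ℕ → 𝓧) :=
  measurable_pi_iff.2 fun j => measurable_pi_apply (max l (min j n))

theorem cl_congr {𝓧 : Type*} {l n : ℕ} (hln : l ≤ n) {x x' : ℕ → 𝓧}
    (h : ∀ j, l ≤ j → j ≤ n → x j = x' j) : cl l n x = cl l n x' := by
  funext j
  exact h _ (le_max_left _ _) (by omega)

theorem cl_apply {𝓧 : Type*} {l n : ℕ} (x : ℕ → 𝓧) {j : ℕ} (h1 : l ≤ j) (h2 : j ≤ n) :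
    cl l n x j = x j := by
  unfold cl
  rw [min_eq_left h2, max_eq_right h1]

theorem obsSigma_eq (Z : ℕ → Ω → 𝓧 × 𝓨) {l n : ℕ} (hln : l ≤ n) :
    obsSigma Z l n = MeasurableSpace.comap (fun ω => cl l n (fun j => (Z j ω).1)) inferInstance := by
  refine le_antisymm (iSup₂_le fun i hi => ?_) ?_
  · have e : (fun ω => (Z i ω).1) = (fun x : ℕ → 𝓧 => x i) ∘ fun ω => cl l n (fun j => (Z j ω).1) := by
      funext ω
      exact (cl_apply (fun j => (Z j ω).1) hi.1 hi.2).symm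
    rw [e, ← MeasurableSpace.comap_comp]
    exact MeasurableSpace.comap_mono (measurable_iff_comap_le.1 (measurable_pi_apply i))
  · refine measurable_iff_comap_le.1 ?_
    rw [@measurable_pi_iff]
    intro j
    have h1 : MeasurableSpace.comap (fun ω => (Z (max l (min j n)) ω).1) inferInstance ≤
        obsSigma Z l n :=
      le_iSup₂_of_le (f := fun i (_ : i ∈ Set.Icc l n) =>
          MeasurableSpace.comap (fun ω => (Z i ω).1) inferInstance)
        (max l (min j n)) ⟨le_max_left _ _, by omega⟩ le_rfl
    exact measurable_iff_comap_le.2 h1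

/-! ### Block indicators -/

/-- The indicator factors of the event `Y_{t:t+m-1} = v`. -/
noncomputable def chiv {m : ℕ} (t : ℕ) (v : Fin m → 𝓨) (k : ℕ) (y : 𝓨) : ℝ≥0∞ :=
  if ∀ i : Fin m, t + (i : ℕ) = k → v i = y then 1 else 0

theorem chiv_lt {m : ℕ} (t : ℕ) (v : Fin m → 𝓨) (k : ℕ) (y : 𝓨) (h : k < t) :
    chiv t v k y = 1 := by
  unfold chiv
  rw [if_pos]
  intro i hi
  omega

theorem pre_chiv_lt {m : ℕ} (t : ℕ) (v : Fin m → 𝓨) (s : ℕ) (h : s ≤ t) (ζ : ℕ → 𝓧 × 𝓨) :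
    pre (chiv t v) s ζ = 1 :=
  Finset.prod_eq_one fun j hj => chiv_lt t v j _ (by have := Finset.mem_range.1 hj; omega)

theorem pre_chiv {m : ℕ} (t n : ℕ) (v : Fin m → 𝓨) (htn : t ≤ n) (Z : ℕ → Ω → 𝓧 × 𝓨) (ω : Ω) :
    pre (chiv t v) (n + m + 1) (fun j => Z j ω) =
      Set.indicator {ω | ∀ i : Fin m, (Z (t + (i : ℕ)) ω).2 = v i} (fun _ => (1 : ℝ≥0∞)) ω := by
  by_cases h : ω ∈ {ω | ∀ i : Fin m, (Z (t + (i : ℕ)) ω).2 = v i}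
  · rw [Set.indicator_of_mem h]
    refine Finset.prod_eq_one fun j _ => ?_
    unfold chiv
    rw [if_pos]
    rintro i rfl
    exact (h i).symm
  · rw [Set.indicator_of_notMem h]
    simp only [Set.mem_setOf_eq, not_forall] at h
    obtain ⟨i, hi⟩ := h
    refine Finset.prod_eq_zero (i := t + i) (Finset.mem_range.2 (by have := i.2; omega)) ?_
    unfold chiv
    rw [if_neg]
    intro h
    exact hi (h i rfl).symm

theorem measurableSet_block {m : ℕ} (t : ℕ) (v : Fin m → 𝓨) {Z : ℕ → Ω → 𝓧 × 𝓨}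
    (hZ : ∀ k, Measurable (Z k)) :
    MeasurableSet {ω | ∀ i : Fin m, (Z (t + (i : ℕ)) ω).2 = v i} := by
  rw [Set.setOf_forall]
  refine MeasurableSet.iInter fun i => ?_
  exact (measurable_snd.comp (hZ _)) (measurableSet_singleton (v i))

theorem sum_block {m : ℕ} (t : ℕ) (Z : ℕ → Ω → 𝓧 × 𝓨) (ω : Ω) :
    ∑ v : Fin m → 𝓨, Set.indicator {ω | ∀ i : Fin m, (Z (t + (i : ℕ)) ω).2 = v i}
      (fun _ => (1 : ℝ≥0∞)) ω = 1 := by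
  rw [Finset.sum_eq_single (fun i : Fin m => (Z (t + (i : ℕ)) ω).2)]
  · rw [Set.indicator_of_mem]
    intro i; rfl
  · intro v _ hv
    rw [Set.indicator_of_notMem]
    intro h
    exact hv (funext fun i => (h i).symm)
  · intro h
    exact absurd (Finset.mem_univ _) h

theorem rep {P : Measure Ω} {Z : ℕ → Ω → 𝓧 × 𝓨} {κ : Kernel (𝓧 × 𝓨) (𝓧 × 𝓨)}
    {μ : Measure 𝓧} {q : 𝓧 × 𝓨 → 𝓧 × 𝓨 → ℝ≥0∞} {p0 : 𝓧 × 𝓨 → ℝ≥0∞}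
    (hPMM : IsPMM P Z κ μ q p0) (l s t n m : ℕ) (hls : l ≤ s) (hst : s ≤ t) (htn : t ≤ n) :
    ∃ (α : 𝓨 → (ℕ → 𝓧) → ℝ≥0∞) (Λ : Measure (ℕ → 𝓧)), (∀ i, Measurable (α i)) ∧
      ∀ v : Fin m → 𝓨, (P.restrict {ω | ∀ i : Fin m, (Z (t + (i : ℕ)) ω).2 = v i}).map
          (fun ω => cl l n (fun j => (Z j ω).1)) =
        Λ.withDensity (fun x => ∑ i, α i x *
          bk q (chiv t v) (gk q (chiv t v) μ m n) (n - s) s x i) := by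
  obtain hP : IsProbabilityMeasure P := hPMM.1
  have hμ : SigmaFinite μ := hPMM.2.2.1
  have hq := hPMM.2.2.2.1
  have hZ := hPMM.2.1.1
  set X : Ω → ℕ → 𝓧 := fun ω j => (Z j ω).1 with hX
  have hXm : Measurable X := measurable_pi_iff.2 fun j => measurable_fst.comp (hZ j)
  have hB : ∀ i, MeasurableSet {ω | (Z s ω).2 = i} := fun i =>
    (measurable_snd.comp (hZ s)) (measurableSet_singleton i)
  set W : Ω → ℕ → 𝓧 := fun ω => cl l s (X ω) with hW
  have hWm : Measurable W := (measurable_cl l s).comp hXm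
  set mi : 𝓨 → Measure (ℕ → 𝓧) := fun i => (P.restrict {ω | (Z s ω).2 = i}).map W with hmi
  have hac : ∀ i, mi i ≪ P.map W := fun i =>
    Measure.AbsolutelyContinuous.map (Measure.restrict_le_self.absolutelyContinuous) hWm
  set U : (ℕ → 𝓧) × ((j : Finset.Ioc s n) → 𝓧) → ℕ → 𝓧 :=
    fun p => Function.updateFinset p.1 (Finset.Ioc s n) p.2 with hU
  have hUm : Measurable U := measurable_updateFinset'
  have hcU : Measurable fun p => cl l n (U p) := (measurable_cl l n).comp hUm
  refine ⟨fun i x => (mi i).rnDeriv (P.map W) (cl l s x),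
    ((P.map X).prod (Measure.pi fun _ => μ)).map (fun p => cl l n (U p)),
    fun i => (Measure.measurable_rnDeriv _ _).comp (measurable_cl l s), fun v => ?_⟩
  set b : (ℕ → 𝓧) → 𝓨 → ℝ≥0∞ := fun x i =>
    bk q (chiv t v) (gk q (chiv t v) μ m n) (n - s) s x i with hb
  have hbm : ∀ i, Measurable fun x => b x i := fun i =>
    measurable_bk hq _ (measurable_gk hq _ μ m n) _ _ _
  have hαm : ∀ i, Measurable fun x : ℕ → 𝓧 => (mi i).rnDeriv (P.map W) (cl l s x) := fun i =>
    (Measure.measurable_rnDeriv _ _).comp (measurable_cl l s)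
  ext D hD
  have hclX : Measurable fun ω => cl l n (X ω) := (measurable_cl l n).comp hXm
  have hfm : Measurable fun x => ∑ i, (mi i).rnDeriv (P.map W) (cl l s x) * b x i :=
    Finset.measurable_sum _ fun i _ => (hαm i).mul (hbm i)
  set G : (ℕ → 𝓧) → ℝ≥0∞ := fun x => D.indicator (fun _ => 1) (cl l n x) with hG
  have hGm : Measurable G := (measurable_const.indicator hD).comp (measurable_cl l n)
  have hGd : ∀ x x' : ℕ → 𝓧, (∀ j, l ≤ j → j ≤ n → x j = x' j) → G x = G x' := by
    intro x x' h
    simp only [hG]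
    rw [cl_congr (by omega) h]
  -- left-hand side
  have hL : (P.restrict {ω | ∀ i : Fin m, (Z (t + (i : ℕ)) ω).2 = v i}).map
      (fun ω => cl l n (X ω)) D
      = ∫⁻ ω, pre (chiv t v) (n + m + 1) (fun j => Z j ω) * G (X ω) ∂P := by
    rw [Measure.map_apply hclX hD, Measure.restrict_apply (hclX hD),
      ← lintegral_indicator_one ((hclX hD).inter (measurableSet_block t v hZ))]
    refine lintegral_congr fun ω => ?_
    rw [pre_chiv t n v htn Z ω, Set.inter_comm, Set.inter_indicator_one]
    rfl
  set J : 𝓨 → (ℕ → 𝓧) → ℝ≥0∞ := fun i => lmarginal (fun _ => μ) (Finset.Ioc s n)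
    (fun x => G x * b x i) with hJ
  have hJm : ∀ i, Measurable (J i) := fun i => (hGm.mul (hbm i)).lmarginal _
  have hJW : ∀ i x, J i (cl l s x) = J i x := by
    intro i x
    simp only [hJ, lmarginal]
    refine lintegral_congr fun z => ?_
    have ha : ∀ j, l ≤ j → j ≤ n → Function.updateFinset (cl l s x) (Finset.Ioc s n) z j
          = Function.updateFinset x (Finset.Ioc s n) z j := by
      intro j h1 h2
      unfold Function.updateFinset
      split_ifs with h
      · rfl
      · exact cl_apply x h1 (by simp only [Finset.mem_Ioc] at h; omega)
    rw [hGd _ _ ha, hb]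
    simp only
    rw [bk_congr q _ _ _ _ _ s i (fun j h1 h2 => ha j (by omega) (by omega))]
  rw [hL, mid_rep hPMM (chiv t v) n m G hGm (fun x x' h => hGd x x' fun j _ h2 => h j h2)
    (n - s) s (by omega)]
  simp only [pre_chiv_lt t v s hst, one_mul]
  -- right-hand side
  have hI : Measurable fun p => D.indicator
      (fun x => ∑ i, (mi i).rnDeriv (P.map W) (cl l s x) * b x i) (cl l n (U p)) :=
    (hfm.indicator hD).comp hcU
  rw [withDensity_apply _ hD, ← lintegral_indicator hD,
    lintegral_map (hfm.indicator hD) hcU,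
    lintegral_prod _ hI.aemeasurable,
    lintegral_map hI.lintegral_prod_right' hXm]
  have hR : ∀ ω, ∫⁻ y, D.indicator (fun x => ∑ i, (mi i).rnDeriv (P.map W) (cl l s x) * b x i)
      (cl l n (U (X ω, y))) ∂(Measure.pi fun _ => μ)
      = ∑ i, (mi i).rnDeriv (P.map W) (W ω) * J i (X ω) := by
    intro ω
    have e1 : ∀ y, D.indicator (fun x => ∑ i, (mi i).rnDeriv (P.map W) (cl l s x) * b x i)
        (cl l n (U (X ω, y))) = ∑ i, (mi i).rnDeriv (P.map W) (W ω) *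
          (G (U (X ω, y)) * b (U (X ω, y)) i) := by
      intro y
      have e2 : cl l s (cl l n (U (X ω, y))) = W ω := by
        refine cl_congr hls fun j h1 h2 => ?_
        rw [cl_apply _ h1 (by omega)]
        simp only [hU, Function.updateFinset]
        rw [dif_neg]
        simp only [Finset.mem_Ioc]; omega
      have e3 : ∀ i, b (cl l n (U (X ω, y))) i = b (U (X ω, y)) i := fun i =>
        bk_congr q _ _ _ _ _ s i (fun j h1 h2 => cl_apply _ (by omega) (by omega))
      by_cases hd : cl l n (U (X ω, y)) ∈ D
      · rw [Set.indicator_of_mem hd]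
        simp only [e2, e3, hG, Set.indicator_of_mem hd, one_mul]
      · rw [Set.indicator_of_notMem hd]
        simp only [hG, Set.indicator_of_notMem hd, zero_mul, mul_zero, Finset.sum_const_zero]
    simp only [e1]
    have hmy : ∀ i, Measurable fun y => G (U (X ω, y)) * b (U (X ω, y)) i := fun i =>
      (hGm.mul (hbm i)).comp (hUm.comp measurable_prodMk_left)
    rw [lintegral_finsetSum _ fun i _ => (hmy i).const_mul _]
    refine Finset.sum_congr rfl fun i _ => ?_
    rw [lintegral_const_mul _ (hmy i)]
    rfl
  refine Eq.trans ?_ (lintegral_congr hR).symm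
  have hpm : ∀ i, Measurable fun ω => (mi i).rnDeriv (P.map W) (W ω) * J i (X ω) := fun i =>
    ((Measure.measurable_rnDeriv _ _).comp hWm).mul ((hJm i).comp hXm)
  rw [lintegral_finsetSum _ fun i _ => hpm i]
  have hS : ∀ ω, lmarginal (fun _ => μ) (Finset.Ioc s n)
      (fun x => G x * b x (Z s ω).2) (X ω)
      = ∑ i, {ω | (Z s ω).2 = i}.indicator (fun ω => J i (X ω)) ω := by
    intro ω
    rw [Finset.sum_eq_single (Z s ω).2]
    · rw [Set.indicator_of_mem (by exact rfl)]
    · intro i _ hi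
      rw [Set.indicator_of_notMem]
      exact fun h => hi h.symm
    · intro h; exact absurd (Finset.mem_univ _) h
  refine (lintegral_congr hS).trans ?_
  have hqm : ∀ i, Measurable ({ω | (Z s ω).2 = i}.indicator (fun ω => J i (X ω))) := fun i =>
    ((hJm i).comp hXm).indicator (hB i)
  rw [lintegral_finsetSum _ fun i _ => hqm i]
  refine Finset.sum_congr rfl fun i _ => ?_
  have hJWX : ∀ ω, J i (X ω) = J i (W ω) := fun ω => (hJW i (X ω)).symm
  simp only [hJWX]
  have hrm : Measurable fun x => (mi i).rnDeriv (P.map W) x * J i x :=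
    (Measure.measurable_rnDeriv _ _).mul (hJm i)
  rw [lintegral_indicator (hB i), ← lintegral_map (hJm i) hWm,
    ← lintegral_rnDeriv_mul (hac i) (hJm i).aemeasurable,
    lintegral_map hrm hWm]

theorem smooth_rep {P : Measure Ω} {Z : ℕ → Ω → 𝓧 × 𝓨} {κ : Kernel (𝓧 × 𝓨) (𝓧 × 𝓨)}
    {μ : Measure 𝓧} {q : 𝓧 × 𝓨 → 𝓧 × 𝓨 → ℝ≥0∞} {p0 : 𝓧 × 𝓨 → ℝ≥0∞}
    (hPMM : IsPMM P Z κ μ q p0) (l s t n m : ℕ) (hls : l ≤ s) (hst : s ≤ t) (htn : t ≤ n) :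
    ∀ᵐ ω ∂P, ∃ γ : 𝓨 → ℝ≥0∞,
      (∑ i, γ i * ∑ v : Fin m → 𝓨, bk q (chiv t v) (gk q (chiv t v) μ m n) (n - s) s
        (fun k => (Z k ω).1) i = 1) ∧
      ∀ v : Fin m → 𝓨, smooth P Z t l n v ω =
        (∑ i, γ i * bk q (chiv t v) (gk q (chiv t v) μ m n) (n - s) s
          (fun k => (Z k ω).1) i).toReal := by
  obtain hP : IsProbabilityMeasure P := hPMM.1
  have hμ : SigmaFinite μ := hPMM.2.2.1
  have hq := hPMM.2.2.2.1
  have hZ := hPMM.2.1.1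
  obtain ⟨α, Λ, hα, hrep⟩ := rep hPMM l s t n m hls hst htn
  have hXm : Measurable fun ω => cl l n (fun j => (Z j ω).1) :=
    (measurable_cl l n).comp (measurable_pi_iff.2 fun j => measurable_fst.comp (hZ j))
  have hB := bayes P _ hXm (fun v : Fin m → 𝓨 => {ω | ∀ i : Fin m, (Z (t + (i : ℕ)) ω).2 = v i})
    (fun v => measurableSet_block t v hZ) (fun ω => sum_block t Z ω) Λ
    (fun v x => ∑ i, α i x * bk q (chiv t v) (gk q (chiv t v) μ m n) (n - s) s x i)
    (fun v => Finset.measurable_sum _ fun i _ =>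
      (hα i).mul (measurable_bk hq _ (measurable_gk hq _ μ m n) _ _ _)) hrep
  filter_upwards [hB] with ω hω
  have hbk : ∀ (v : Fin m → 𝓨) i, bk q (chiv t v) (gk q (chiv t v) μ m n) (n - s) s
      (cl l n (fun j => (Z j ω).1)) i = bk q (chiv t v) (gk q (chiv t v) μ m n) (n - s) s
      (fun k => (Z k ω).1) i := fun v i =>
    bk_congr q _ _ _ _ _ s i fun j h1 h2 => cl_apply _ (by omega) (by omega)
  simp only [hbk] at hω
  obtain ⟨⟨h0, h1⟩, h2⟩ := hω
  set b : (Fin m → 𝓨) → 𝓨 → ℝ≥0∞ := fun v i =>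
    bk q (chiv t v) (gk q (chiv t v) μ m n) (n - s) s (fun k => (Z k ω).1) i with hb
  set a : 𝓨 → ℝ≥0∞ := fun i => α i (cl l n (fun j => (Z j ω).1)) with ha
  set F : ℝ≥0∞ := ∑ v, ∑ i, a i * b v i with hF
  refine ⟨fun i => a i / F, ?_, fun v => ?_⟩
  · have : ∑ i, a i / F * ∑ v, b v i = F / F := by
      have hF' : F = ∑ i, a i * ∑ v, b v i := (sum_swap_mass b a).symm
      rw [div_eq_mul_inv F]
      conv_rhs => rw [hF', Finset.sum_mul]
      rw [← hF']
      refine Finset.sum_congr rfl fun i _ => ?_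
      rw [div_eq_mul_inv, mul_right_comm]
    exact this.trans (ENNReal.div_self h0 h1)
  · rw [smooth, obsSigma_eq Z (by omega)]
    rw [h2 v]
    congr 1
    rw [div_eq_mul_inv, Finset.sum_mul]
    refine Finset.sum_congr rfl fun i _ => ?_
    show _ = a i / F * _
    rw [div_eq_mul_inv (a i), mul_right_comm]

/-- Proposition 2. Under **A1** and the bounds
`1/n₀ ≤ p_{ij}(x_{1:r}) ≤ n₀` on `E × Y⁺`, with `ρ = 1 − n₀⁻²`: for all
`n ≥ t ≥ s ≥ l` and `m ≥ 1` and every `k = 0, …, r'−1` (`r' = R`), almost surely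
`‖ν^t_{l:n;m} − ν^t_{s:n;m}‖_TV ≤ 2 ρ^{κ_k(X_{s:t})}`, and the same holds with the
backward counter `κ̄(X_{s:t})`. -/
theorem tv_bound_dobrushin
    [TopologicalSpace 𝓧] [PolishSpace 𝓧] [BorelSpace 𝓧]
    (P : Measure Ω) (Z : ℕ → Ω → 𝓧 × 𝓨) (κ : Kernel (𝓧 × 𝓨) (𝓧 × 𝓨)) (μ : Measure 𝓧)
    (q : 𝓧 × 𝓨 → 𝓧 × 𝓨 → ℝ≥0∞) (p0 : 𝓧 × 𝓨 → ℝ≥0∞)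
    {R : ℕ} (E : Set (Fin (R + 1) → 𝓧)) (Yp : Set (𝓨 × 𝓨))
    (hPMM : IsPMM P Z κ μ q p0)
    (hA1 : Assumption1 q E Yp)
    (n₀ : ℕ) (hn₀ : 1 ≤ n₀)
    (hbound : ∀ x ∈ E, ∀ p ∈ Yp,
      ((n₀ : ℝ≥0∞))⁻¹ ≤ pijD q x p.1 p.2 ∧ pijD q x p.1 p.2 ≤ (n₀ : ℝ≥0∞)) :
    ∀ l s t n m kk : ℕ, l ≤ s → s ≤ t → t ≤ n → 1 ≤ m → kk < R →
      ∀ᵐ ω ∂P,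
        tvBlock P Z t l s n m ω ≤ 2 * (1 - ((n₀ : ℝ) ^ 2)⁻¹) ^ kapCount Z E s t kk ω ∧
        tvBlock P Z t l s n m ω ≤ 2 * (1 - ((n₀ : ℝ) ^ 2)⁻¹) ^ kapBar Z E s t ω := by
  intro l s t n m kk hls hst htn hm hkk
  filter_upwards [smooth_rep hPMM l s t n m hls hst htn, smooth_rep hPMM s s t n m le_rfl hst htn]
    with ω ⟨γ, h1, h2⟩ ⟨γ', h1', h2'⟩
  have hc := contrBd_counts q (fun v : Fin m → 𝓨 => chiv t v)
    (fun v => gk q (chiv t v) μ m n) Z ω E Yp hA1 n₀ hn₀ hbound s t n kk hst htn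
    (fun v a y h => chiv_lt t v a y h)
  have e : tvBlock P Z t l s n m ω = ∑ v : Fin m → 𝓨,
      |(∑ i, γ i * bk q (chiv t v) (gk q (chiv t v) μ m n) (n - s) s
          (fun k => (Z k ω).1) i).toReal -
        (∑ i, γ' i * bk q (chiv t v) (gk q (chiv t v) μ m n) (n - s) s
          (fun k => (Z k ω).1) i).toReal| := by
    unfold tvBlock
    simp only [h2, h2']
  rw [e]
  have ha := hc.1 1 γ γ' ENNReal.one_ne_top h1 h1'
  have hb := hc.2 1 γ γ' ENNReal.one_ne_top h1 h1'
  rw [ENNReal.toReal_one, mul_one] at ha hb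
  exact ⟨ha, hb⟩

end PMMPaper
end
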